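/- arXiv:2412.16753 — 2 statements merged into one kernel-verified Lean document; each statement's English description precedes it below -/
import Mathlib

section
/- Let Φ={φ_i}_{i∈Λ} be an analytic IFS on I=[0,1] with 0<|φ_i'(x)|<1 for all i∈Λ and x∈I, whose maps have no common fixed point, let p be a positive probability vector and μ the associated exact dimensional self-conformal measure. For each 0<ε<1 there exists M(ε)≥1 such that for each m≥M(ε) there exists N(ε,m)≥1 such that for all n≥N(ε,m) the following holds: if ψ:I→ℝ is C¹ with ε ≤ |ψ'(x)| ≤ ε^{-1} for all x∈I, then, setting θ:=ψμ, ℙ_{1≤i≤n}( |(1/m)H(θ_{x,i}, D_{i+m}) − dim μ| < ε ) > 1−ε, where i is uniform in {1,…,n} and x is distributed according to θ. -/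
open MeasureTheory Filter Set Metric Topology

noncomputable section

/-- The unit interval `I = [0,1]`. -/
def unitI : Set ℝ := Set.Icc 0 1

/-- For a word `u = i₁…iₙ`, `compWord φ u = φ_{i₁} ∘ … ∘ φ_{iₙ}`. -/
def compWord {Λ : Type*} (φ : Λ → ℝ → ℝ) : List Λ → ℝ → ℝ
  | [] => id
  | i :: u => φ i ∘ compWord φ u

/-- `μ` is exact dimensional with dimension `d`. -/
def ExactDimWith (μ : Measure ℝ) (d : ℝ) : Prop :=
  ∀ᵐ x ∂μ, Tendsto (fun δ : ℝ =>
      Real.log (μ (Metric.closedBall x δ)).toReal / Real.log δ)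
    (nhdsWithin 0 (Set.Ioi 0)) (nhds d)

/-- The level-`n` dyadic interval `[m/2^n, (m+1)/2^n)`. -/
def dyadIco (n : ℕ) (m : ℤ) : Set ℝ :=
  Set.Ico ((m : ℝ) / 2 ^ n) (((m : ℝ) + 1) / 2 ^ n)

/-- Entropy of a measure on `ℝ` with respect to the level-`n` dyadic partition
(logarithms in base 2). -/
def ent1 (n : ℕ) (θ : Measure ℝ) : ℝ :=
  -∑' m : ℤ, (θ (dyadIco n m)).toReal * Real.logb 2 (θ (dyadIco n m)).toReal

/-- The level-`n` dyadic cell containing `x`. -/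
def dcell (n : ℕ) (x : ℝ) : Set ℝ := dyadIco n ⌊x * 2 ^ n⌋

/-- The level-`n` component `θ_{x,n}`: `θ` conditioned on the dyadic cell of `x`. -/
def dcomp (θ : Measure ℝ) (x : ℝ) (n : ℕ) : Measure ℝ :=
  (θ (dcell n x))⁻¹ • θ.restrict (dcell n x)

/-- Base-2 entropy of a finite family of weights. -/
def finEnt {ι : Type*} (S : Finset ι) (T : ι → ℝ) : ℝ :=
  -∑ w ∈ S, T w * Real.logb 2 (T w)

theorem neg_mul_logb_nonneg {x : ℝ} (h0 : 0 ≤ x) (h1 : x ≤ 1) : 0 ≤ -(x * Real.logb 2 x) := by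
  have : Real.logb 2 x ≤ 0 := Real.logb_nonpos (by norm_num) h0 h1
  nlinarith

theorem finEnt_nonneg {ι : Type*} (S : Finset ι) (T : ι → ℝ) (h0 : ∀ w ∈ S, 0 ≤ T w)
    (h1 : ∀ w ∈ S, T w ≤ 1) : 0 ≤ finEnt S T := by
  rw [finEnt, ← Finset.sum_neg_distrib]
  exact Finset.sum_nonneg fun w hw => neg_mul_logb_nonneg (h0 w hw) (h1 w hw)

section Fibers

variable {ι κ : Type*} [DecidableEq κ]

/-- Entropy of the weights `T` conditioned on the fibre of `π` over `z`. -/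
def fiberEnt (S : Finset ι) (π : ι → κ) (T : ι → ℝ) (t : κ → ℝ) (z : κ) : ℝ :=
  finEnt (S.filter fun w => π w = z) fun w => T w / t z

theorem fiberEnt_nonneg (S : Finset ι) (π : ι → κ) (T : ι → ℝ) (hT : ∀ w, 0 ≤ T w)
    (t : κ → ℝ) (z : κ) (ht : t z = ∑ w ∈ S.filter (fun w => π w = z), T w) :
    0 ≤ fiberEnt S π T t z := by
  have htz : 0 ≤ t z := by rw [ht]; exact Finset.sum_nonneg fun w _ => hT w
  refine finEnt_nonneg _ _ (fun w _ => div_nonneg (hT w) htz) fun w hw => ?_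
  refine div_le_one_of_le₀ ?_ htz
  rw [ht]
  exact Finset.single_le_sum (f := T) (fun w _ => hT w) hw

theorem sum_mul_fiberEnt (S : Finset ι) (S' : Finset κ) (π : ι → κ) (hπ : ∀ w ∈ S, π w ∈ S')
    (T : ι → ℝ) (hT : ∀ w, 0 ≤ T w) (t : κ → ℝ)
    (ht : ∀ z, t z = ∑ w ∈ S.filter (fun w => π w = z), T w) :
    ∑ z ∈ S', t z * fiberEnt S π T t z = finEnt S T - finEnt S' t := by
  have key : ∀ z ∈ S', t z * fiberEnt S π T t z =
      t z * Real.logb 2 (t z) - ∑ w ∈ S.filter (fun w => π w = z), T w * Real.logb 2 (T w) := by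
    intro z _
    rcases eq_or_ne (t z) 0 with h0 | h0
    · have : ∀ w ∈ S.filter (fun w => π w = z), T w = 0 :=
        (Finset.sum_eq_zero_iff_of_nonneg fun w _ => hT w).1 ((ht z).symm.trans h0)
      rw [h0, Finset.sum_eq_zero fun w hw => by rw [this w hw, zero_mul]]
      simp
    · rw [fiberEnt, finEnt, mul_neg, Finset.mul_sum]
      have : ∀ w ∈ S.filter (fun w => π w = z),
          t z * (T w / t z * Real.logb 2 (T w / t z)) =
            T w * Real.logb 2 (T w) - T w * Real.logb 2 (t z) := by
        intro w _
        rcases eq_or_ne (T w) 0 with h1 | h1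
        · simp [h1]
        · rw [Real.logb_div h1 h0]; field_simp
      rw [Finset.sum_congr rfl this, Finset.sum_sub_distrib, ← Finset.sum_mul, ← ht z]
      ring
  rw [Finset.sum_congr rfl key, Finset.sum_sub_distrib, Finset.sum_fiberwise_of_maps_to hπ]
  simp only [finEnt]
  ring

theorem le_fiberEnt (S : Finset ι) (π : ι → κ) (T : ι → ℝ) (hT : ∀ w, 0 ≤ T w)
    (t : κ → ℝ) (z : κ) (ht : t z = ∑ w ∈ S.filter (fun w => π w = z), T w) (htz : 0 < t z)
    {a s : ℝ} (hs : s ≤ 1)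
    (hbad : ∑ w ∈ S.filter (fun w => π w = z) with ¬ T w ≤ a * t (π w), T w < s * t z) :
    (1 - s) * (-Real.logb 2 a) ≤ fiberEnt S π T t z := by
  have hnn := fiberEnt_nonneg S π T hT t z ht
  rcases lt_or_ge (-Real.logb 2 a) 0 with hl | hl
  · nlinarith
  set F := S.filter fun w => π w = z with hF
  have hle : ∀ w ∈ F, T w / t z ≤ 1 := fun w hw => by
    refine div_le_one_of_le₀ ?_ htz.le
    rw [ht]
    exact Finset.single_le_sum (f := T) (fun w _ => hT w) hw
  have h1 : ∑ w ∈ F with T w ≤ a * t (π w), T w / t z * (-Real.logb 2 a) ≤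
      fiberEnt S π T t z := by
    rw [fiberEnt, finEnt, ← hF, ← Finset.sum_neg_distrib]
    refine (Finset.sum_le_sum fun w hw => ?_).trans
      (Finset.sum_le_sum_of_subset_of_nonneg (Finset.filter_subset _ _) fun w hw _ =>
        neg_mul_logb_nonneg (div_nonneg (hT w) htz.le) (hle w hw))
    obtain ⟨hw1, hw2⟩ := Finset.mem_filter.1 hw
    have hpz : π w = z := (Finset.mem_filter.1 hw1).2
    rcases (hT w).eq_or_lt with h0 | h0
    · simp [← h0]
    · rw [hpz] at hw2
      have h3 : T w / t z ≤ a := (div_le_iff₀ htz).2 hw2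
      have h4 : Real.logb 2 (T w / t z) ≤ Real.logb 2 a :=
        Real.logb_le_logb_of_le (by norm_num) (by positivity) h3
      have h5 : 0 < T w / t z := by positivity
      nlinarith
  refine le_trans ?_ h1
  rw [← Finset.sum_mul, ← Finset.sum_div]
  refine mul_le_mul_of_nonneg_right ?_ hl
  rw [le_div_iff₀ htz]
  have h2 := Finset.sum_filter_add_sum_filter_not F (fun w => T w ≤ a * t (π w)) T
  rw [← ht] at h2
  linarith

/-- If the weights `T` are, up to a small error, spread out over neighbourhoods `N` of the fibres,
then most fibres carry large entropy. -/
theorem sum_low_fiberEnt_le (S : Finset ι) (S' : Finset κ) (π : ι → κ) (hπ : ∀ w ∈ S, π w ∈ S')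
    (T : ι → ℝ) (hT : ∀ w, 0 ≤ T w) (t : κ → ℝ)
    (ht : ∀ z, t z = ∑ w ∈ S.filter (fun w => π w = z), T w)
    (b : ι → ℝ) (N : κ → ℝ) {k δ δ' A s : ℝ} (hk : 0 < k) (hδ' : 0 < δ') (hs : 0 < s)
    (hs1 : s ≤ 1) (hb0 : ∀ w, 0 ≤ b w) (hb : ∑ w ∈ S, b w ≤ δ) (hN0 : ∀ z, 0 ≤ N z)
    (hN : ∑ z ∈ S', N z ≤ A) (hTN : ∀ w ∈ S, T w ≤ k * N (π w) + b w) :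
    ∑ z ∈ S' with fiberEnt S π T t z < (1 - s) * (-Real.logb 2 (2 * k / δ')), t z ≤
      (2 * δ + δ' * A) / s := by
  set a := 2 * k / δ' with ha
  have ha0 : 0 < a := by positivity
  have ht0 : ∀ z, 0 ≤ t z := fun z => by rw [ht]; exact Finset.sum_nonneg fun w _ => hT w
  have hbadw : ∀ w ∈ S, ¬ T w ≤ a * t (π w) →
      T w ≤ 2 * b w + if t (π w) ≤ δ' * N (π w) then T w else 0 := by
    intro w hw hbad
    split_ifs with h
    · linarith [hb0 w]
    · by_contra! hc
      refine hbad ?_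
      have h1 := hTN w hw
      have h2 : T w ≤ 2 * k * N (π w) := by linarith
      have h3 : a * (δ' * N (π w)) ≤ a * t (π w) :=
        mul_le_mul_of_nonneg_left (le_of_lt (not_le.1 h)) ha0.le
      have h4 : a * (δ' * N (π w)) = 2 * k * N (π w) := by rw [ha]; field_simp
      linarith
  have hbad : ∑ w ∈ S with ¬ T w ≤ a * t (π w), T w ≤ 2 * δ + δ' * A := by
    calc ∑ w ∈ S with ¬ T w ≤ a * t (π w), T w
        ≤ ∑ w ∈ S with ¬ T w ≤ a * t (π w),
            (2 * b w + if t (π w) ≤ δ' * N (π w) then T w else 0) :=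
          Finset.sum_le_sum fun w hw =>
            hbadw w (Finset.mem_filter.1 hw).1 (Finset.mem_filter.1 hw).2
      _ ≤ ∑ w ∈ S, (2 * b w + if t (π w) ≤ δ' * N (π w) then T w else 0) := by
          refine Finset.sum_le_sum_of_subset_of_nonneg (Finset.filter_subset _ _) fun w _ _ => ?_
          have := hb0 w
          have := hT w
          split_ifs <;> linarith
      _ = 2 * ∑ w ∈ S, b w + ∑ w ∈ S, if t (π w) ≤ δ' * N (π w) then T w else 0 := by
          rw [Finset.sum_add_distrib, Finset.mul_sum]
      _ ≤ 2 * δ + δ' * A := by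
          gcongr
          rw [← Finset.sum_fiberwise_of_maps_to hπ]
          calc _ ≤ ∑ z ∈ S', δ' * N z := by
                refine Finset.sum_le_sum fun z _ => ?_
                have : ∑ w ∈ S with π w = z, (if t (π w) ≤ δ' * N (π w) then T w else 0) =
                    if t z ≤ δ' * N z then t z else 0 := by
                  rw [Finset.sum_congr rfl (g := fun w => if t z ≤ δ' * N z then T w else 0)]
                  · split_ifs with h
                    · exact (ht z).symm
                    · simp
                  · intro w hw
                    rw [(Finset.mem_filter.1 hw).2]
                rw [this]
                have := hN0 z
                split_ifs with h
                · exact h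
                · positivity
            _ ≤ δ' * A := by
                rw [← Finset.mul_sum]
                gcongr
  rw [le_div_iff₀ hs, Finset.sum_mul]
  refine le_trans ?_ hbad
  rw [← Finset.sum_fiberwise_of_maps_to (s := S.filter fun w => ¬ T w ≤ a * t (π w)) (t := S')
    (g := π) fun w hw => hπ w (Finset.mem_filter.1 hw).1]
  refine le_trans ?_ (Finset.sum_le_sum_of_subset_of_nonneg (Finset.filter_subset
    (fun z => fiberEnt S π T t z < (1 - s) * (-Real.logb 2 a)) S')
    fun z _ _ => Finset.sum_nonneg fun w _ => hT w)
  refine Finset.sum_le_sum fun z hz => ?_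
  have hlow := (Finset.mem_filter.1 hz).2
  rcases (ht0 z).eq_or_lt with h0 | h0
  · rw [← h0, zero_mul]
    exact Finset.sum_nonneg fun w _ => hT w
  by_contra hc
  rw [not_le] at hc
  refine absurd (le_fiberEnt S π T hT t z (ht z) h0 hs1 ?_) (not_le.2 hlow)
  rw [Finset.filter_comm, mul_comm s]
  exact hc

end Fibers

/-- The Gibbs inequality. -/
theorem finEnt_le_cross {ι : Type*} (S : Finset ι) (T q : ι → ℝ) (hT : ∀ w, 0 ≤ T w)
    (hT1 : ∑ w ∈ S, T w = 1) (hq : ∀ w ∈ S, 0 < q w) (hq1 : ∑ w ∈ S, q w ≤ 1) :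
    finEnt S T ≤ ∑ w ∈ S, T w * -Real.logb 2 (q w) := by
  have hl : 0 < Real.log 2 := Real.log_pos (by norm_num)
  have key : ∀ w ∈ S, -(T w * Real.logb 2 (T w)) - T w * -Real.logb 2 (q w) ≤
      (q w - T w) / Real.log 2 := by
    intro w hw
    have hqw := hq w hw
    rcases (hT w).eq_or_lt with h0 | h0
    · rw [← h0]
      simpa using div_nonneg hqw.le hl.le
    · rw [le_div_iff₀ hl]
      have h1 := Real.log_le_sub_one_of_pos (div_pos hqw h0)
      rw [Real.log_div hqw.ne' h0.ne'] at h1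
      have h2 : (-(T w * Real.logb 2 (T w)) - T w * -Real.logb 2 (q w)) * Real.log 2 =
          T w * (Real.log (q w) - Real.log (T w)) := by
        simp only [Real.logb]; field_simp; ring
      rw [h2]
      calc T w * (Real.log (q w) - Real.log (T w)) ≤ T w * (q w / T w - 1) := by gcongr
        _ = q w - T w := by field_simp
  have h := Finset.sum_le_sum key
  rw [Finset.sum_sub_distrib, ← Finset.sum_div, Finset.sum_sub_distrib, hT1] at h
  have h3 : (∑ w ∈ S, q w - 1) / Real.log 2 ≤ 0 := div_nonpos_of_nonpos_of_nonneg (by linarith) hl.le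
  rw [finEnt, ← Finset.sum_neg_distrib]
  linarith

/-- The index of the level-`J` dyadic cell containing `x`. -/
def dkey (J : ℕ) (x : ℝ) : ℤ := ⌊x * 2 ^ J⌋

theorem measurable_dkey (J : ℕ) : Measurable (dkey J) :=
  Int.measurable_floor.comp (measurable_id.mul_const _)

theorem mem_dyadIco {J : ℕ} {z : ℤ} {x : ℝ} : x ∈ dyadIco J z ↔ dkey J x = z := by
  have h : (0 : ℝ) < 2 ^ J := by positivity
  rw [dyadIco, dkey, Set.mem_Ico, Int.floor_eq_iff, div_le_iff₀ h, lt_div_iff₀ h]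

theorem dyadIco_eq_preimage (J : ℕ) (z : ℤ) : dyadIco J z = dkey J ⁻¹' {z} := by
  ext x
  exact mem_dyadIco

theorem measurableSet_dyadIco (J : ℕ) (z : ℤ) : MeasurableSet (dyadIco J z) :=
  measurableSet_Ico

theorem dkey_add_div (i m : ℕ) (x : ℝ) : dkey (i + m) x / 2 ^ m = dkey i x := by
  have := Int.mul_natCast_floor_div_cancel (n := 2 ^ m) (by positivity) (x * 2 ^ i)
  rw [dkey, dkey, ← this, pow_add]
  push_cast
  rw [mul_assoc]

theorem abs_dkey_sub_le {J : ℕ} {x y : ℝ} {L : ℕ} (h : |x - y| * 2 ^ J ≤ L) :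
    |dkey J x - dkey J y| ≤ L := by
  have h2 : (0 : ℝ) < 2 ^ J := by positivity
  rw [← abs_of_pos h2, ← abs_mul, sub_mul, abs_le] at h
  have a1 := Int.floor_le (x * 2 ^ J)
  have a2 := Int.lt_floor_add_one (x * 2 ^ J)
  have b1 := Int.floor_le (y * 2 ^ J)
  have b2 := Int.lt_floor_add_one (y * 2 ^ J)
  have c1 : (dkey J x : ℝ) - dkey J y < L + 1 := by simp only [dkey]; linarith
  have c2 : (dkey J y : ℝ) - dkey J x < L + 1 := by simp only [dkey]; linarith
  rw [abs_le]
  constructor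
  · have : dkey J y - dkey J x < L + 1 := by exact_mod_cast c2
    linarith
  · have : dkey J x - dkey J y < L + 1 := by exact_mod_cast c1
    linarith

/-- The mass of the level-`J` dyadic cell of index `z`. -/
def wt (θ : Measure ℝ) (J : ℕ) (z : ℤ) : ℝ := θ.real (dyadIco J z)

theorem wt_nonneg (θ : Measure ℝ) (J : ℕ) (z : ℤ) : 0 ≤ wt θ J z := measureReal_nonneg

section Support

variable {θ : Measure ℝ} [IsFiniteMeasure θ] {J : ℕ} {S : Finset ℤ}

open scoped Classical in
theorem measureReal_dkey (hS : ∀ᵐ x ∂θ, dkey J x ∈ S) (P : ℤ → Prop) :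
    θ.real {x | P (dkey J x)} = ∑ z ∈ S with P z, wt θ J z := by
  have h := sum_measureReal_preimage_singleton (μ := θ) (S.filter P) (f := dkey J)
    fun z _ => measurable_dkey J (measurableSet_singleton z)
  simp only [wt, dyadIco_eq_preimage]
  rw [h]
  refine measureReal_congr ?_
  filter_upwards [hS] with x hx
  refine propext ?_
  change P (dkey J x) ↔ dkey J x ∈ (↑(S.filter P) : Set ℤ)
  simp [hx]

theorem sum_wt (hS : ∀ᵐ x ∂θ, dkey J x ∈ S) : ∑ z ∈ S, wt θ J z = θ.real univ := by
  classical
  have := measureReal_dkey hS fun _ => True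
  simpa using this.symm

theorem wt_eq_zero (hS : ∀ᵐ x ∂θ, dkey J x ∈ S) {z : ℤ} (hz : z ∉ S) : wt θ J z = 0 := by
  classical
  have := measureReal_dkey hS fun w => w = z
  rw [wt, dyadIco_eq_preimage]
  refine this.trans ?_
  refine Finset.sum_eq_zero fun w hw => ?_
  simp only [Finset.mem_filter] at hw
  exact absurd (hw.2 ▸ hw.1) hz

theorem wt_eq_sum_children {i m : ℕ} (hS : ∀ᵐ x ∂θ, dkey (i + m) x ∈ S) (z : ℤ) :
    wt θ i z = ∑ w ∈ S with w / 2 ^ m = z, wt θ (i + m) w := by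
  have := measureReal_dkey hS fun w => w / 2 ^ m = z
  simp only [dkey_add_div] at this
  rw [wt, dyadIco_eq_preimage]
  refine this.trans ?_
  exact Finset.sum_congr (by ext; simp) fun _ _ => rfl

theorem dcell_eq (i : ℕ) (x : ℝ) : dcell i x = dyadIco i (dkey i x) := rfl

theorem ent1_dcomp {i m : ℕ} (hS : ∀ᵐ x ∂θ, dkey (i + m) x ∈ S) (x : ℝ) :
    ent1 (i + m) (dcomp θ x i) =
      fiberEnt S (fun w => w / 2 ^ m) (wt θ (i + m)) (wt θ i) (dkey i x) := by
  have h1 : ∀ w : ℤ, (dcomp θ x i (dyadIco (i + m) w)).toReal =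
      if w / 2 ^ m = dkey i x then wt θ (i + m) w / wt θ i (dkey i x) else 0 := by
    intro w
    rw [dcomp, Measure.smul_apply, Measure.restrict_apply (measurableSet_dyadIco _ _), smul_eq_mul,
      ENNReal.toReal_mul, ENNReal.toReal_inv, dcell_eq]
    split_ifs with h
    · have : dyadIco (i + m) w ∩ dyadIco i (dkey i x) = dyadIco (i + m) w := by
        refine Set.inter_eq_left.2 fun y hy => ?_
        rw [mem_dyadIco] at hy ⊢
        rw [← dkey_add_div i m y, hy, h]
      rw [this, div_eq_inv_mul]
      rfl
    · have : dyadIco (i + m) w ∩ dyadIco i (dkey i x) = ∅ := by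
        refine Set.eq_empty_of_forall_notMem fun y hy => h ?_
        rw [Set.mem_inter_iff, mem_dyadIco, mem_dyadIco] at hy
        rw [← hy.2, ← dkey_add_div i m y, hy.1]
      rw [this]
      simp
  rw [ent1, fiberEnt, finEnt, tsum_eq_sum (s := S)]
  · rw [Finset.sum_filter]
    congr 1
    refine Finset.sum_congr rfl fun w _ => ?_
    rw [h1 w]
    split_ifs <;> simp
  · intro w hw
    rw [h1 w, wt_eq_zero hS hw]
    simp

end Support

/-- Indices of the level-`J` dyadic cells meeting `[a, b]`. -/
def cells (a b : ℝ) (J : ℕ) : Finset ℤ := Finset.Icc ⌊a * 2 ^ J⌋ ⌊b * 2 ^ J⌋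

theorem dkey_mem_cells {a b x : ℝ} (hx : x ∈ Set.Icc a b) (J : ℕ) : dkey J x ∈ cells a b J :=
  Finset.mem_Icc.2 ⟨Int.floor_mono (by gcongr; exact hx.1), Int.floor_mono (by gcongr; exact hx.2)⟩

theorem div_mem_cells {a b : ℝ} {i m : ℕ} {w : ℤ} (hw : w ∈ cells a b (i + m)) :
    w / 2 ^ m ∈ cells a b i := by
  rw [cells, Finset.mem_Icc] at hw ⊢
  have ha := dkey_add_div i m a
  have hb := dkey_add_div i m b
  simp only [dkey] at ha hb
  rw [← ha, ← hb]
  exact ⟨Int.ediv_le_ediv (by positivity) hw.1, Int.ediv_le_ediv (by positivity) hw.2⟩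

theorem card_cells_le {a b : ℝ} (hab : a ≤ b) (J : ℕ) :
    ((cells a b J).card : ℝ) ≤ (b - a + 2) * 2 ^ J := by
  have h2 : (1 : ℝ) ≤ 2 ^ J := one_le_pow₀ (by norm_num)
  have hm : ⌊a * 2 ^ J⌋ ≤ ⌊b * 2 ^ J⌋ := Int.floor_mono (by gcongr)
  have hc : ((cells a b J).card : ℝ) = ⌊b * 2 ^ J⌋ + 1 - ⌊a * 2 ^ J⌋ := by
    rw [cells, Int.card_Icc]
    have : (((⌊b * 2 ^ J⌋ + 1 - ⌊a * 2 ^ J⌋).toNat : ℤ) : ℝ) =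
        ((⌊b * 2 ^ J⌋ + 1 - ⌊a * 2 ^ J⌋ : ℤ) : ℝ) := by
      rw [Int.toNat_of_nonneg (by linarith)]
    push_cast at this
    exact this
  rw [hc]
  have a2 := Int.lt_floor_add_one (a * 2 ^ J)
  have b1 := Int.floor_le (b * 2 ^ J)
  nlinarith

theorem measurable_measure_closedBall (μ : Measure ℝ) [SFinite μ] (r : ℝ) :
    Measurable fun x => μ (Metric.closedBall x r) := by
  have hs : MeasurableSet {q : ℝ × ℝ | dist q.2 q.1 ≤ r} :=
    (isClosed_le (continuous_snd.dist continuous_fst) continuous_const).measurableSet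
  exact measurable_measure_prodMk_left hs

theorem tendsto_half_pow_nhdsGT : Tendsto (fun k : ℕ => (1 / 2 : ℝ) ^ k) atTop (𝓝[>] 0) :=
  tendsto_nhdsWithin_iff.2 ⟨tendsto_pow_atTop_nhds_zero_of_lt_one (by norm_num) (by norm_num),
    Eventually.of_forall fun k => by simp⟩

theorem ExactDimWith.nonneg {μ : Measure ℝ} [IsProbabilityMeasure μ] {d : ℝ}
    (hdim : ExactDimWith μ d) : 0 ≤ d := by
  obtain ⟨x, hx⟩ := Eventually.exists hdim
  refine ge_of_tendsto (hx.comp tendsto_half_pow_nhdsGT) (Eventually.of_forall fun k => ?_)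
  refine div_nonneg_of_nonpos (Real.log_nonpos ENNReal.toReal_nonneg ?_)
    (Real.log_nonpos (by positivity) (pow_le_one₀ (by norm_num) (by norm_num)))
  exact measureReal_le_one

/-- An exact dimensional measure has uniform power bounds for small dyadic balls off a set of small
measure. -/
theorem ExactDimWith.exists_regular_set {μ : Measure ℝ} [IsProbabilityMeasure μ] {d : ℝ}
    (hdim : ExactDimWith μ d) {δ : ℝ} (hδ : 0 < δ) :
    ∃ E : Set ℝ, MeasurableSet E ∧ μ Eᶜ ≤ ENNReal.ofReal δ ∧ ∃ k₀ : ℕ, ∀ k ≥ k₀, ∀ x ∈ E,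
      (2 : ℝ) ^ (-(k * (d + δ))) ≤ μ.real (Metric.closedBall x ((1 / 2) ^ k)) ∧
        μ.real (Metric.closedBall x ((1 / 2) ^ k)) ≤ (2 : ℝ) ^ (-(k * (d - δ))) := by
  set f : ℕ → ℝ → ℝ := fun k x =>
    Real.log (μ (Metric.closedBall x ((1 / 2) ^ k))).toReal / Real.log ((1 / 2) ^ k) with hf
  have hfm : ∀ k, StronglyMeasurable (f k) := fun k =>
    (((Real.measurable_log.comp (measurable_measure_closedBall μ _).ennreal_toReal)).div_const
      _).stronglyMeasurable
  have hlim : ∀ᵐ x ∂μ, Tendsto (fun k => f k x) atTop (𝓝 d) := by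
    filter_upwards [hdim] with x hx
    exact hx.comp tendsto_half_pow_nhdsGT
  obtain ⟨t, htm, hμt, hunif⟩ := tendstoUniformlyOn_of_ae_tendsto' hfm
    (stronglyMeasurable_const (b := d)) hlim hδ
  obtain ⟨Z, hZs, hZm, hZ0⟩ := exists_measurable_superset_of_null (Measure.measure_compl_support
    (μ := μ))
  refine ⟨tᶜ \ Z, htm.compl.diff hZm, ?_, ?_⟩
  · refine (measure_mono (t := t ∪ Z) ?_).trans ((measure_union_le _ _).trans ?_)
    · intro x hx
      by_contra h
      simp only [mem_union, not_or] at h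
      exact hx ⟨h.1, h.2⟩
    · rw [hZ0, add_zero]
      exact hμt
  · obtain ⟨k₀, hk₀⟩ := eventually_atTop.1 (Metric.tendstoUniformlyOn_iff.1 hunif δ hδ)
    refine ⟨max k₀ 1, fun k hk x hx => ?_⟩
    have hx1 := hk₀ k (le_trans (le_max_left _ _) hk) x hx.1
    have hk1 : (1 : ℝ) ≤ k := by exact_mod_cast le_trans (le_max_right _ _) hk
    have hxs : x ∈ μ.support := by
      by_contra h
      exact hx.2 (hZs h)
    have hpos : 0 < μ.real (Metric.closedBall x ((1 / 2) ^ k)) :=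
      ENNReal.toReal_pos ((Measure.mem_support_iff_forall x).1 hxs _
        (Metric.closedBall_mem_nhds x (by positivity))).ne' (measure_ne_top _ _)
    have hl2 : 0 < Real.log 2 := Real.log_pos (by norm_num)
    have hlog : Real.log ((1 / 2) ^ k) = -(k * Real.log 2) := by
      rw [Real.log_pow, one_div, Real.log_inv]
      ring
    rw [Real.dist_eq, abs_lt] at hx1
    simp only [hf, hlog] at hx1
    rw [div_neg] at hx1
    set v := μ.real (Metric.closedBall x ((1 / 2) ^ k)) with hv
    change -δ < d - -(Real.log v / _) ∧ d - -(Real.log v / _) < δ at hx1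
    have hq : 0 < k * Real.log 2 := by positivity
    have h1 : (-(d + δ)) * (k * Real.log 2) < Real.log v := (lt_div_iff₀ hq).1 (by linarith)
    have h2 : Real.log v < (-(d - δ)) * (k * Real.log 2) := (div_lt_iff₀ hq).1 (by linarith)
    rw [← Real.exp_log hpos, Real.rpow_def_of_pos (by norm_num), Real.rpow_def_of_pos (by norm_num)]
    constructor
    · exact Real.exp_le_exp.2 (by linarith)
    · exact Real.exp_le_exp.2 (by linarith)

theorem sum_wt_comp_le (θ : Measure ℝ) [IsFiniteMeasure θ] (J : ℕ) (S : Finset ℤ) {f : ℤ → ℤ}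
    (hf : Function.Injective f) : ∑ z ∈ S, wt θ J (f z) ≤ θ.real univ := by
  have h := sum_measureReal_preimage_singleton (μ := θ) (S.image f) (f := dkey J)
    fun z _ => measurable_dkey J (measurableSet_singleton z)
  rw [Finset.sum_image hf.injOn] at h
  simp only [wt, dyadIco_eq_preimage]
  rw [h]
  exact measureReal_mono (subset_univ _)

/-- The mass of the level-`J` dyadic cells within `L` steps of the cell of index `z`. -/
def nbWt (θ : Measure ℝ) (J L : ℕ) (z : ℤ) : ℝ :=
  ∑ j ∈ Finset.Icc (-L : ℤ) L, wt θ J (z + j)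

theorem nbWt_nonneg (θ : Measure ℝ) (J L : ℕ) (z : ℤ) : 0 ≤ nbWt θ J L z :=
  Finset.sum_nonneg fun _ _ => wt_nonneg _ _ _

theorem sum_nbWt_le (θ : Measure ℝ) [IsFiniteMeasure θ] (J L : ℕ) (S : Finset ℤ) :
    ∑ z ∈ S, nbWt θ J L z ≤ (2 * L + 1) * θ.real univ := by
  simp only [nbWt]
  rw [Finset.sum_comm]
  refine (Finset.sum_le_sum fun j _ => sum_wt_comp_le θ J S (add_left_injective j)).trans ?_
  rw [Finset.sum_const, Int.card_Icc, nsmul_eq_mul]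
  have : ((L : ℤ) + 1 - -L).toNat = 2 * L + 1 := by omega
  rw [this]
  push_cast
  exact le_rfl

theorem measureReal_closedBall_le_nbWt (θ : Measure ℝ) [IsFiniteMeasure θ] (J L : ℕ) (y : ℝ) :
    θ.real (Metric.closedBall y (L / 2 ^ J)) ≤ nbWt θ J L (dkey J y) := by
  refine (measureReal_mono (s₂ := ⋃ j ∈ Finset.Icc (-L : ℤ) L, dyadIco J (dkey J y + j)) ?_
    (measure_ne_top _ _)).trans (measureReal_biUnion_finset_le _ _)
  intro x hx
  rw [Metric.mem_closedBall, Real.dist_eq, le_div_iff₀ (by positivity)] at hx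
  have h := abs_le.1 (abs_dkey_sub_le hx)
  simp only [mem_iUnion, mem_dyadIco]
  exact ⟨dkey J x - dkey J y, Finset.mem_Icc.2 h, by ring⟩

/-- Upper bound for the entropy of an image of an upper regular measure under a Lipschitz map. -/
theorem finEnt_map_le {μ : Measure ℝ} [IsProbabilityMeasure μ] (hμI : μ unitIᶜ = 0)
    {E : Set ℝ} (hE : MeasurableSet E) {δ D : ℝ} (hδ : 0 ≤ δ) (hD : 0 ≤ D)
    (hμE : μ Eᶜ ≤ ENNReal.ofReal δ)
    {N c : ℕ} (hreg : ∀ x ∈ E, (2 : ℝ) ^ (-(((N + c : ℕ) : ℝ) * D)) ≤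
      μ.real (Metric.closedBall x ((1 / 2) ^ (N + c))))
    {ψ : ℝ → ℝ} (hψ : Measurable ψ)
    (hlip : ∀ x ∈ unitI, ∀ y ∈ unitI, |ψ x - ψ y| ≤ 2 ^ c * |x - y|)
    {a b : ℝ} (hab : b - a ≤ 2 ^ (c + 1)) (hψI : MapsTo ψ unitI (Set.Icc a b)) :
    finEnt (cells a b N) (wt (μ.map ψ) N) ≤
      Real.logb 2 6 + ((N + c : ℕ) : ℝ) * D + δ * (N + c + 3) := by
  have hIae : ∀ᵐ x ∂μ, x ∈ unitI := by rwa [ae_iff]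
  set S := cells a b N with hS
  set θ := μ.map ψ with hθ
  have hθp : IsProbabilityMeasure θ := Measure.isProbabilityMeasure_map hψ.aemeasurable
  have hsupp : ∀ᵐ x ∂θ, dkey N x ∈ S := by
    refine (ae_map_iff hψ.aemeasurable (measurable_dkey N S.measurableSet)).2 ?_
    filter_upwards [hIae] with x hx using dkey_mem_cells (hψI hx) N
  have hsum1 : ∑ w ∈ S, wt θ N w = 1 := by rw [sum_wt hsupp, probReal_univ]
  have hSne : S.Nonempty := by
    by_contra h
    rw [Finset.not_nonempty_iff_eq_empty.1 h] at hsum1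
    simp at hsum1
  have hcard : (0 : ℝ) < S.card := by exact_mod_cast hSne.card_pos
  have hab0 : a ≤ b := by
    have := hψI (show (0 : ℝ) ∈ unitI from ⟨le_rfl, zero_le_one⟩)
    exact this.1.trans this.2
  set q : ℤ → ℝ := fun w => nbWt θ N 1 w / 6 + 1 / (2 * S.card) with hq
  have hq0 : ∀ w, 0 < q w := fun w => by
    have := nbWt_nonneg θ N 1 w
    simp only [hq]
    positivity
  have hq1 : ∑ w ∈ S, q w ≤ 1 := by
    simp only [hq]
    rw [Finset.sum_add_distrib, ← Finset.sum_div, Finset.sum_const, nsmul_eq_mul]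
    have h1 := sum_nbWt_le θ N 1 S
    rw [probReal_univ] at h1
    have h2 : (S.card : ℝ) * (1 / (2 * S.card)) = 1 / 2 := by field_simp
    rw [h2]
    norm_num at h1
    linarith
  refine (finEnt_le_cross S (wt θ N) q (wt_nonneg θ N) hsum1 (fun w _ => hq0 w) hq1).trans ?_
  set θE := (μ.restrict E).map ψ with hθE
  set θB := (μ.restrict Eᶜ).map ψ with hθB
  have hsplit : ∀ w, wt θ N w = wt θE N w + wt θB N w := by
    intro w
    have hm := measurableSet_dyadIco N w
    simp only [wt, hθ, hθE, hθB]
    rw [map_measureReal_apply hψ hm, map_measureReal_apply hψ hm, map_measureReal_apply hψ hm,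
      measureReal_restrict_apply (hψ hm), measureReal_restrict_apply (hψ hm),
      ← Set.sdiff_eq, measureReal_inter_add_sdiff hE]
  have hbB : ∀ w, -Real.logb 2 (q w) ≤ N + c + 3 := by
    intro w
    have h1 : (2 : ℝ) ^ (-((N + c + 3 : ℕ) : ℝ)) ≤ q w := by
      have h2 : 1 / (2 * (S.card : ℝ)) ≤ q w := by
        have := nbWt_nonneg θ N 1 w
        simp only [hq]
        linarith
      refine le_trans ?_ h2
      rw [Real.rpow_neg (by norm_num), Real.rpow_natCast, ← one_div]
      refine one_div_le_one_div_of_le (by positivity) ?_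
      have h3 := card_cells_le hab0 N
      have h4 : (1 : ℝ) ≤ 2 ^ c := one_le_pow₀ (by norm_num)
      calc 2 * (S.card : ℝ) ≤ 2 * ((b - a + 2) * 2 ^ N) := by gcongr
        _ ≤ 2 * ((2 ^ (c + 1) + 2 * 2 ^ c) * 2 ^ N) := by gcongr; linarith
        _ = 2 ^ (N + c + 3) := by ring
    have := Real.logb_le_logb_of_le (b := 2) (by norm_num) (by positivity) h1
    rw [Real.logb_rpow (by norm_num) (by norm_num)] at this
    push_cast at this
    linarith
  have hbE : ∀ w, wt θE N w ≠ 0 → -Real.logb 2 (q w) ≤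
      Real.logb 2 6 + ((N + c : ℕ) : ℝ) * D := by
    intro w hw
    obtain ⟨x, hxE, hxI, hxw⟩ : ∃ x ∈ E, x ∈ unitI ∧ ψ x ∈ dyadIco N w := by
      by_contra! h
      refine hw ?_
      have hm := measurableSet_dyadIco N w
      rw [wt, map_measureReal_apply hψ hm, measureReal_restrict_apply (hψ hm), measureReal_def,
        measure_mono_null (fun x hx => fun hxI => h x hx.2 hxI hx.1) hμI, ENNReal.toReal_zero]
    have h1 : μ.real (Metric.closedBall x ((1 / 2) ^ (N + c))) ≤ nbWt θ N 1 w := by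
      have h2 := measureReal_closedBall_le_nbWt θ N 1 (ψ x)
      rw [mem_dyadIco.1 hxw] at h2
      refine le_trans ?_ h2
      rw [hθ, map_measureReal_apply hψ Metric.isClosed_closedBall.measurableSet]
      refine ENNReal.toReal_mono (measure_ne_top _ _) (measure_mono_ae ?_)
      filter_upwards [hIae] with y hyI hy
      have hy' : |y - x| ≤ (1 / 2) ^ (N + c) := hy
      change |ψ y - ψ x| ≤ _
      refine (hlip y hyI x hxI).trans ?_
      calc (2 : ℝ) ^ c * |y - x| ≤ 2 ^ c * (1 / 2) ^ (N + c) := by gcongr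
        _ = ((1 : ℕ) : ℝ) / 2 ^ N := by
          rw [pow_add, one_div, inv_pow, inv_pow]
          field_simp
          simp
    have h3 : (2 : ℝ) ^ (-(((N + c : ℕ) : ℝ) * D)) / 6 ≤ q w := by
      have := (hreg x hxE).trans h1
      have h4 : 0 ≤ 1 / (2 * (S.card : ℝ)) := by positivity
      simp only [hq]
      linarith
    have := Real.logb_le_logb_of_le (b := 2) (by norm_num) (by positivity) h3
    rw [Real.logb_div (by positivity) (by norm_num), Real.logb_rpow (by norm_num) (by norm_num)]
      at this
    linarith
  have hEsum : ∑ w ∈ S, wt θE N w ≤ 1 := by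
    refine (sum_wt_comp_le θE N S Function.injective_id).trans ?_
    rw [map_measureReal_apply hψ MeasurableSet.univ, preimage_univ, measureReal_restrict_apply_univ]
    exact measureReal_le_one
  have hBsum : ∑ w ∈ S, wt θB N w ≤ δ := by
    refine (sum_wt_comp_le θB N S Function.injective_id).trans ?_
    rw [map_measureReal_apply hψ MeasurableSet.univ, preimage_univ, measureReal_restrict_apply_univ]
    exact ENNReal.toReal_le_of_le_ofReal hδ hμE
  have h6 : 0 ≤ Real.logb 2 6 := Real.logb_nonneg (by norm_num) (by norm_num)
  set A := Real.logb 2 6 + ((N + c : ℕ) : ℝ) * D with hA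
  have hA0 : 0 ≤ A := by positivity
  calc ∑ w ∈ S, wt θ N w * -Real.logb 2 (q w)
      ≤ ∑ w ∈ S, (wt θE N w * A + wt θB N w * (N + c + 3)) := by
        refine Finset.sum_le_sum fun w _ => ?_
        rw [hsplit w, add_mul]
        refine add_le_add ?_ (mul_le_mul_of_nonneg_left (hbB w) (wt_nonneg _ _ _))
        by_cases h : wt θE N w = 0
        · rw [h, zero_mul, zero_mul]
        · exact mul_le_mul_of_nonneg_left (hbE w h) (wt_nonneg _ _ _)
    _ = (∑ w ∈ S, wt θE N w) * A + (∑ w ∈ S, wt θB N w) * (N + c + 3) := by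
        rw [Finset.sum_add_distrib, Finset.sum_mul, Finset.sum_mul]
    _ ≤ 1 * A + δ * (N + c + 3) := by gcongr
    _ = A + δ * (N + c + 3) := by ring

/-- Up to a relative error `δ`, the measure `ν` gives to a level-`J` dyadic cell at most a fraction
`κ` of the mass it gives to concentric balls of radius `R`. -/
def Spread (δ κ : ENNReal) (J : ℕ) (R : ℝ) (ν : Measure ℝ) : Prop :=
  ∃ g b : Measure ℝ, ν = g + b ∧ b univ ≤ δ * ν univ ∧
    ∀ y, g (dyadIco J (dkey J y)) ≤ κ * ν (Metric.closedBall y R)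

theorem Spread.sum {Λ : Type*} [Fintype Λ] {δ κ : ENNReal} {J : ℕ} {R : ℝ} {ν : Λ → Measure ℝ}
    (h : ∀ i, Spread δ κ J R (ν i)) (p : Λ → ENNReal) : Spread δ κ J R (∑ i, p i • ν i) := by
  choose g b hν hb hg using h
  refine ⟨∑ i, p i • g i, ∑ i, p i • b i, ?_, ?_, fun y => ?_⟩
  · rw [← Finset.sum_add_distrib]
    refine Finset.sum_congr rfl fun i _ => ?_
    rw [← smul_add, ← hν i]
  · simp only [Measure.coe_finsetSum, Finset.sum_apply, Measure.smul_apply, smul_eq_mul]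
    rw [Finset.mul_sum]
    refine Finset.sum_le_sum fun i _ => ?_
    rw [mul_left_comm]
    gcongr
    exact hb i
  · simp only [Measure.coe_finsetSum, Finset.sum_apply, Measure.smul_apply, smul_eq_mul]
    rw [Finset.mul_sum]
    refine Finset.sum_le_sum fun i _ => ?_
    rw [mul_left_comm]
    gcongr
    exact hg i y

/-- Images of a measure under bi-Lipschitz maps at scale `2⁻ⁱ` are spread out. -/
theorem spread_map {μ : Measure ℝ} [IsProbabilityMeasure μ] (hμI : μ unitIᶜ = 0)
    {E : Set ℝ} (hE : MeasurableSet E) {δ κ : ENNReal} (hμE : μ Eᶜ ≤ δ) {i c k : ℕ}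
    (hreg : ∀ x ∈ E, μ (Metric.closedBall x ((1 / 2) ^ k)) ≤ κ)
    {g : ℝ → ℝ} (hg : Measurable g)
    (hlo : ∀ x ∈ unitI, ∀ y ∈ unitI, |x - y| ≤ 2 ^ (c + i) * |g x - g y|)
    (hup : ∀ x ∈ unitI, ∀ y ∈ unitI, |g x - g y| ≤ 2 ^ c / 2 ^ i * |x - y|) :
    Spread δ κ (i + (c + k)) (2 ^ (c + 1) / 2 ^ i) (μ.map g) := by
  have hIae : ∀ᵐ x ∂μ, x ∈ unitI := by rwa [ae_iff]
  refine ⟨(μ.restrict E).map g, (μ.restrict Eᶜ).map g, ?_, ?_, fun y => ?_⟩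
  · rw [← Measure.map_add _ _ hg, Measure.restrict_add_restrict_compl hE]
  · rw [Measure.map_apply hg MeasurableSet.univ, Measure.map_apply hg MeasurableSet.univ,
      preimage_univ, Measure.restrict_apply_univ, measure_univ, mul_one]
    exact hμE
  · set C := dyadIco (i + (c + k)) (dkey (i + (c + k)) y) with hC
    have hCm : MeasurableSet C := measurableSet_dyadIco _ _
    rw [Measure.map_apply hg hCm, Measure.restrict_apply (hg hCm)]
    have hCd : ∀ s ∈ C, ∀ t ∈ C, |s - t| ≤ 1 / 2 ^ (i + (c + k)) := by
      intro s hs t ht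
      rw [hC, dyadIco, add_div] at hs ht
      rw [abs_le]
      constructor <;> linarith [hs.1, hs.2, ht.1, ht.2]
    by_cases hne : ∃ x ∈ unitI, x ∈ E ∧ g x ∈ C
    · obtain ⟨x, hxI, hxE, hxC⟩ := hne
      have h1 : μ (g ⁻¹' C ∩ E) ≤ κ := by
        refine le_trans (measure_mono_ae ?_) (hreg x hxE)
        filter_upwards [hIae] with z hzI hz
        change |z - x| ≤ _
        refine (hlo z hzI x hxI).trans ?_
        calc (2 : ℝ) ^ (c + i) * |g z - g x| ≤ 2 ^ (c + i) * (1 / 2 ^ (i + (c + k))) := by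
              gcongr
              exact hCd _ hz.1 _ hxC
          _ = (1 / 2) ^ k := by
              rw [one_div_pow, pow_add, pow_add, pow_add]
              field_simp
      have h2 : μ.map g (Metric.closedBall y (2 ^ (c + 1) / 2 ^ i)) = 1 := by
        rw [Measure.map_apply hg Metric.isClosed_closedBall.measurableSet, ← measure_univ (μ := μ)]
        refine measure_congr ?_
        filter_upwards [hIae] with z hzI
        refine propext ⟨fun _ => trivial, fun _ => ?_⟩
        change |g z - y| ≤ _
        have hzx : |z - x| ≤ 1 := by
          rw [abs_le]
          constructor <;> linarith [hzI.1, hzI.2, hxI.1, hxI.2]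
        have h3 : |g x - y| ≤ 2 ^ c / 2 ^ i := by
          refine (hCd _ hxC y (mem_dyadIco.2 rfl)).trans ?_
          rw [pow_add, ← div_div, div_right_comm]
          gcongr
          refine (div_le_one_of_le₀ (one_le_pow₀ (by norm_num)) (by positivity)).trans
            (one_le_pow₀ (by norm_num))
        calc |g z - y| ≤ |g z - g x| + |g x - y| := abs_sub_le _ _ _
          _ ≤ 2 ^ c / 2 ^ i * 1 + 2 ^ c / 2 ^ i := by
              refine add_le_add ((hup z hzI x hxI).trans ?_) h3
              gcongr
          _ = 2 ^ (c + 1) / 2 ^ i := by ring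
      rw [h2, mul_one]
      exact h1
    · push Not at hne
      have : μ (g ⁻¹' C ∩ E) = 0 :=
        measure_mono_null (fun x hx => fun hxI => hne x hxI hx.2 hx.1) hμI
      rw [this]
      exact zero_le

section Words

variable {Λ : Type*} {f : Λ → ℝ → ℝ} {c₀ r L : ℝ}

theorem compWord_append (f : Λ → ℝ → ℝ) (u v : List Λ) :
    compWord f (u ++ v) = compWord f u ∘ compWord f v := by
  induction u with
  | nil => rfl
  | cons i u ih => rw [List.cons_append, compWord, ih, compWord, Function.comp_assoc]

theorem mapsTo_compWord (hf : ∀ i, MapsTo (f i) unitI unitI) (u : List Λ) :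
    MapsTo (compWord f u) unitI unitI := by
  induction u with
  | nil => exact mapsTo_id _
  | cons i u ih => exact (hf i).comp ih

theorem measurable_compWord (hf : ∀ i, Measurable (f i)) (u : List Λ) :
    Measurable (compWord f u) := by
  induction u with
  | nil => exact measurable_id
  | cons i u ih => exact (hf i).comp ih

theorem abs_compWord_sub_le (hf : ∀ i, MapsTo (f i) unitI unitI) (hr : 0 ≤ r)
    (hup : ∀ i, ∀ x ∈ unitI, ∀ y ∈ unitI, |f i x - f i y| ≤ r * |x - y|) (u : List Λ)
    {x y : ℝ} (hx : x ∈ unitI) (hy : y ∈ unitI) :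
    |compWord f u x - compWord f u y| ≤ r ^ u.length := by
  induction u with
  | nil =>
    simp only [compWord, id, List.length_nil, pow_zero]
    rw [abs_le]
    constructor <;> linarith [hx.1, hx.2, hy.1, hy.2]
  | cons i u ih =>
    rw [List.length_cons, pow_succ']
    exact (hup i _ (mapsTo_compWord hf u hx) _ (mapsTo_compWord hf u hy)).trans
      (mul_le_mul_of_nonneg_left ih hr)

/-- Bounded distortion of compositions. -/
theorem compWord_distortion (hf : ∀ i, MapsTo (f i) unitI unitI) (hr : 0 ≤ r) (hr1 : r < 1)
    (hup : ∀ i, ∀ x ∈ unitI, ∀ y ∈ unitI, |f i x - f i y| ≤ r * |x - y|)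
    (hdist : ∀ i ρ, ∀ x ∈ unitI, ∀ y ∈ unitI, ∀ x' ∈ unitI, ∀ y' ∈ unitI,
      |x - x'| ≤ ρ → |x - y'| ≤ ρ → |y - x'| ≤ ρ → |y - y'| ≤ ρ →
      |f i x - f i y| * |x' - y'| ≤ Real.exp (L * ρ) * |f i x' - f i y'| * |x - y|)
    (u : List Λ) {x y x' y' : ℝ} (hx : x ∈ unitI) (hy : y ∈ unitI) (hx' : x' ∈ unitI)
    (hy' : y' ∈ unitI) :
    |compWord f u x - compWord f u y| * |x' - y'| ≤
      Real.exp (L * ((1 - r ^ u.length) / (1 - r))) *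
        |compWord f u x' - compWord f u y'| * |x - y| := by
  induction u with
  | nil =>
    simp only [compWord, id, List.length_nil, pow_zero, sub_self, zero_div, mul_zero,
      Real.exp_zero, one_mul]
    exact (mul_comm _ _).le
  | cons i u ih =>
    have hab := fun {s t : ℝ} (hs : s ∈ unitI) (ht : t ∈ unitI) =>
      abs_compWord_sub_le hf hr hup u hs ht
    have h1 := hdist i _ _ (mapsTo_compWord hf u hx) _ (mapsTo_compWord hf u hy) _
      (mapsTo_compWord hf u hx') _ (mapsTo_compWord hf u hy') (hab hx hx') (hab hx hy')
      (hab hy hx') (hab hy hy')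
    have hr' : 1 - r ≠ 0 := by linarith
    have hexp : Real.exp (L * ((1 - r ^ (u.length + 1)) / (1 - r))) =
        Real.exp (L * r ^ u.length) * Real.exp (L * ((1 - r ^ u.length) / (1 - r))) := by
      rw [← Real.exp_add]
      congr 1
      field_simp
      ring
    rw [List.length_cons, hexp]
    simp only [compWord, Function.comp_apply]
    set a := compWord f u x
    set b := compWord f u y
    set a' := compWord f u x'
    set b' := compWord f u y'
    set K := Real.exp (L * ((1 - r ^ u.length) / (1 - r)))
    set e := Real.exp (L * r ^ u.length)
    have hK : 0 < K := Real.exp_pos _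
    have he : 0 < e := Real.exp_pos _
    rcases eq_or_ne a b with h | h
    · rw [h, sub_self, abs_zero, zero_mul]
      positivity
    rcases eq_or_ne a' b' with h' | h'
    · rw [h', sub_self, abs_zero, mul_zero, zero_mul] at ih
      have h3 : |a - b| * |x' - y'| = 0 := le_antisymm ih (by positivity)
      rcases mul_eq_zero.1 h3 with h4 | h4
      · exact absurd (sub_eq_zero.1 (abs_eq_zero.1 h4)) h
      · rw [h4, mul_zero]
        positivity
    have hA : 0 < |a - b| := abs_pos.2 (sub_ne_zero.2 h)
    have hA' : 0 < |a' - b'| := abs_pos.2 (sub_ne_zero.2 h')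
    refine le_of_mul_le_mul_right ?_ (mul_pos hA hA')
    calc |f i a - f i b| * |x' - y'| * (|a - b| * |a' - b'|)
        = (|f i a - f i b| * |a' - b'|) * (|a - b| * |x' - y'|) := by ring
      _ ≤ (e * |f i a' - f i b'| * |a - b|) * (K * |a' - b'| * |x - y|) := by gcongr
      _ = e * K * |f i a' - f i b'| * |x - y| * (|a - b| * |a' - b'|) := by ring

/-- A property of maps that passes from all the compositions `g ∘ f i` to `g`, and that holds for
maps which are bi-Lipschitz at a given scale, holds for the identity. -/
theorem stopping_induction [Nonempty Λ] (hf : ∀ i, MapsTo (f i) unitI unitI)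
    (hfm : ∀ i, Measurable (f i)) (hc₀ : 0 < c₀) (hr : 0 ≤ r) (hr1 : r < 1) (hL : 0 ≤ L)
    (hlo : ∀ i, ∀ x ∈ unitI, ∀ y ∈ unitI, c₀ * |x - y| ≤ |f i x - f i y|)
    (hup : ∀ i, ∀ x ∈ unitI, ∀ y ∈ unitI, |f i x - f i y| ≤ r * |x - y|)
    (hdist : ∀ i ρ, ∀ x ∈ unitI, ∀ y ∈ unitI, ∀ x' ∈ unitI, ∀ y' ∈ unitI,
      |x - x'| ≤ ρ → |x - y'| ≤ ρ → |y - x'| ≤ ρ → |y - y'| ≤ ρ →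
      |f i x - f i y| * |x' - y'| ≤ Real.exp (L * ρ) * |f i x' - f i y'| * |x - y|)
    {K : ℝ} (hK : K = Real.exp (L / (1 - r))) {t : ℝ} (ht : 0 < t) (ht1 : t ≤ 1)
    {P : (ℝ → ℝ) → Prop} (hstep : ∀ g, (∀ i, P (g ∘ f i)) → P g)
    (hbase : ∀ g, Measurable g → MapsTo g unitI unitI →
      (∀ x ∈ unitI, ∀ y ∈ unitI, c₀ / K ^ 2 * t * |x - y| ≤ |g x - g y|) →
      (∀ x ∈ unitI, ∀ y ∈ unitI, |g x - g y| ≤ K * t * |x - y|) → P g) : P id := by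
  have h0 : (0 : ℝ) ∈ unitI := ⟨le_rfl, zero_le_one⟩
  have h1 : (1 : ℝ) ∈ unitI := ⟨zero_le_one, le_rfl⟩
  have hK0 : 0 < K := hK ▸ Real.exp_pos _
  set ρ : List Λ → ℝ := fun u => |compWord f u 0 - compWord f u 1| with hρ
  have hdK : ∀ u : List Λ, ∀ x ∈ unitI, ∀ y ∈ unitI, ∀ x' ∈ unitI, ∀ y' ∈ unitI,
      |compWord f u x - compWord f u y| * |x' - y'| ≤
        K * |compWord f u x' - compWord f u y'| * |x - y| := by
    intro u x hx y hy x' hx' y' hy'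
    refine (compWord_distortion hf hr hr1 hup hdist u hx hy hx' hy').trans ?_
    gcongr
    rw [hK, Real.exp_le_exp, div_eq_mul_one_div L]
    gcongr
    linarith [pow_nonneg hr u.length]
  have hle : ∀ u : List Λ, ∀ x ∈ unitI, ∀ y ∈ unitI,
      |compWord f u x - compWord f u y| ≤ K * ρ u * |x - y| := by
    intro u x hx y hy
    simpa using hdK u x hx y hy 0 h0 1 h1
  have hge : ∀ u : List Λ, ∀ x ∈ unitI, ∀ y ∈ unitI,
      ρ u / K * |x - y| ≤ |compWord f u x - compWord f u y| := by
    intro u x hx y hy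
    have := hdK u 0 h0 1 h1 x hx y hy
    rw [zero_sub, abs_neg, abs_one, mul_one] at this
    rw [div_mul_eq_mul_div, div_le_iff₀ hK0, mul_comm _ K]
    exact this
  obtain ⟨n, hn⟩ := exists_pow_lt_of_lt_one ht hr1
  have main : ∀ k : ℕ, ∀ u : List Λ, u.length + k = n → c₀ / K * t ≤ ρ u → P (compWord f u) := by
    intro k
    have hgood : ∀ u : List Λ, c₀ / K * t ≤ ρ u → ρ u ≤ t → P (compWord f u) := by
      intro u hu hut
      refine hbase _ (measurable_compWord hfm u) (mapsTo_compWord hf u) (fun x hx y hy => ?_)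
        fun x hx y hy => ?_
      · refine le_trans ?_ (hge u x hx y hy)
        gcongr
        calc c₀ / K ^ 2 * t = c₀ / K * t / K := by field_simp
          _ ≤ ρ u / K := by gcongr
      · refine (hle u x hx y hy).trans ?_
        gcongr
    induction k with
    | zero =>
      intro u hu hcu
      refine hgood u hcu ?_
      have := abs_compWord_sub_le hf hr hup u h0 h1
      rw [add_zero] at hu
      rw [hu] at this
      exact this.trans hn.le
    | succ k ih =>
      intro u hu hcu
      rcases le_or_gt (ρ u) t with h | h
      · exact hgood u hcu h
      · refine hstep _ fun i => ?_
        have hap := compWord_append f u [i]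
        have hi : compWord f [i] = f i := rfl
        rw [hi] at hap
        rw [← hap]
        refine ih _ (by rw [List.length_append, List.length_singleton]; omega) ?_
        simp only [hρ, hap, Function.comp_apply]
        refine le_trans ?_ (hge u _ (hf i h0) _ (hf i h1))
        have h3 := hlo i 0 h0 1 h1
        rw [zero_sub, abs_neg, abs_one, mul_one] at h3
        calc c₀ / K * t = t / K * c₀ := by ring
          _ ≤ ρ u / K * |f i 0 - f i 1| := by gcongr
  refine main n [] (by simp) ?_
  simp only [hρ, compWord, id, zero_sub, abs_neg, abs_one]
  obtain ⟨i⟩ := ‹Nonempty Λ›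
  have hc1 : c₀ ≤ r := by
    have h2 := hlo i 0 h0 1 h1
    have h3 := hup i 0 h0 1 h1
    rw [zero_sub, abs_neg, abs_one, mul_one] at h2 h3
    exact h2.trans h3
  have hK1 : 1 ≤ K := by
    rw [hK]
    exact Real.one_le_exp (div_nonneg hL (by linarith))
  calc c₀ / K * t ≤ 1 * 1 := by
        gcongr
        rw [div_le_one hK0]
        linarith
    _ = 1 := one_mul 1

end Words

/-- For a spread out measure, most components have large entropy. -/
theorem Spread.sum_low_le {θ : Measure ℝ} [IsProbabilityMeasure θ] {δ κ : ℝ} (hδ : 0 ≤ δ)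
    (hκ : 0 < κ) {i m L : ℕ}
    (hθ : Spread (ENNReal.ofReal δ) (ENNReal.ofReal κ) (i + m) (L / 2 ^ i) θ)
    {a b : ℝ} (hS : ∀ᵐ x ∂θ, x ∈ Set.Icc a b) {δ' s : ℝ} (hδ' : 0 < δ') (hs : 0 < s)
    (hs1 : s ≤ 1) :
    ∑ z ∈ cells a b i with fiberEnt (cells a b (i + m)) (fun w => w / 2 ^ m) (wt θ (i + m))
      (wt θ i) z < (1 - s) * (-Real.logb 2 (2 * κ / δ')), wt θ i z ≤
      (2 * δ + δ' * (2 * L + 1)) / s := by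
  obtain ⟨g, e, hge, he, hg⟩ := hθ
  rw [measure_univ (μ := θ), mul_one] at he
  have hgle : g ≤ θ := hge ▸ Measure.le_add_right le_rfl
  have hele : e ≤ θ := hge ▸ Measure.le_add_left le_rfl
  have hgf : IsFiniteMeasure g := isFiniteMeasure_of_le θ hgle
  have hef : IsFiniteMeasure e := isFiniteMeasure_of_le θ hele
  have hS' : ∀ᵐ x ∂θ, dkey (i + m) x ∈ cells a b (i + m) := by
    filter_upwards [hS] with x hx using dkey_mem_cells hx _
  refine sum_low_fiberEnt_le _ _ _ (fun w hw => div_mem_cells hw) _ (wt_nonneg θ _) _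
    (fun z => wt_eq_sum_children hS' z) (wt e (i + m)) (nbWt θ i L) hκ hδ' hs hs1 (wt_nonneg e _)
    ?_ (nbWt_nonneg θ i L) ?_ fun w _ => ?_
  · exact (sum_wt_comp_le e _ _ Function.injective_id).trans (ENNReal.toReal_le_of_le_ofReal hδ he)
  · simpa using sum_nbWt_le θ i L (cells a b i)
  · set y : ℝ := w / 2 ^ (i + m) with hy
    have hyw : dkey (i + m) y = w := by
      rw [dkey, hy, div_mul_cancel₀ _ (by positivity), Int.floor_intCast]
    have h1 : wt θ (i + m) w = wt g (i + m) w + wt e (i + m) w := by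
      simp only [wt]
      rw [hge, measureReal_add_apply]
    have h2 : wt g (i + m) w ≤ κ * θ.real (Metric.closedBall y (L / 2 ^ i)) := by
      have h3 := hg y
      rw [hyw] at h3
      have h4 := ENNReal.toReal_mono
        (ENNReal.mul_ne_top ENNReal.ofReal_ne_top (measure_ne_top _ _)) h3
      rwa [ENNReal.toReal_mul, ENNReal.toReal_ofReal hκ.le] at h4
    have h5 := measureReal_closedBall_le_nbWt θ i L y
    rw [← dkey_add_div i m, hyw] at h5
    rw [h1]
    gcongr
    exact h2.trans (mul_le_mul_of_nonneg_left h5 hκ.le)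

theorem finEnt_le_finEnt_of_fibers {ι κ : Type*} [DecidableEq κ] (S : Finset ι) (S' : Finset κ)
    (π : ι → κ) (hπ : ∀ w ∈ S, π w ∈ S') (T : ι → ℝ) (hT : ∀ w, 0 ≤ T w) (t : κ → ℝ)
    (ht : ∀ z, t z = ∑ w ∈ S.filter (fun w => π w = z), T w) : finEnt S' t ≤ finEnt S T := by
  have h := sum_mul_fiberEnt S S' π hπ T hT t ht
  have : 0 ≤ ∑ z ∈ S', t z * fiberEnt S π T t z := Finset.sum_nonneg fun z _ =>
    mul_nonneg (by rw [ht]; exact Finset.sum_nonneg fun w _ => hT w)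
      (fiberEnt_nonneg S π T hT t z (ht z))
  linarith

/-- Telescoping bound for sums of increments of a monotone nonnegative sequence. -/
theorem sum_Icc_shift_sub_le {h : ℕ → ℝ} (hm : Monotone h) (h0 : ∀ j, 0 ≤ h j) (n m : ℕ) :
    ∑ i ∈ Finset.Icc 1 n, (h (i + m) - h i) ≤ m * h (n + m) := by
  have key : ∑ i ∈ Finset.Icc 1 n, (h (i + m) - h i) =
      ∑ j ∈ Finset.range m, (h (n + j + 1) - h (j + 1)) := by
    induction n with
    | zero => simp
    | succ n ih =>
      rw [Finset.sum_Icc_succ_top (by omega), ih]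
      have h2 := Finset.sum_range_sub (fun j => h (n + j + 1)) m
      have h3 : ∀ j, h (n + 1 + j + 1) - h (j + 1) =
          (h (n + j + 1) - h (j + 1)) + (h (n + (j + 1) + 1) - h (n + j + 1)) := fun j => by
        rw [show n + 1 + j + 1 = n + (j + 1) + 1 by ring]
        ring
      rw [Finset.sum_congr rfl fun j _ => h3 j, Finset.sum_add_distrib, h2]
      rw [show n + m + 1 = n + 1 + m by ring]
  rw [key]
  calc _ ≤ ∑ j ∈ Finset.range m, h (n + m) := by
        refine Finset.sum_le_sum fun j hj => ?_
        have h1 : h (n + j + 1) ≤ h (n + m) := hm (by have := Finset.mem_range.1 hj; omega)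
        linarith [h0 (j + 1)]
    _ = m * h (n + m) := by simp

/-- Concentration of a nonnegative function whose mean is controlled from above by a value that it
rarely falls short of. -/
theorem sum_dev_le {κ : Type*} (S : Finset κ) (t F : κ → ℝ) (ht : ∀ z, 0 ≤ t z)
    (ht1 : ∑ z ∈ S, t z = 1) (hF : ∀ z ∈ S, 0 ≤ F z) {d η τ ε : ℝ} (hε : 0 < ε) (hη : 0 ≤ η)
    (hηε : η < ε) (hd : 0 ≤ d) (hlow : ∑ z ∈ S with F z < d - η, t z ≤ τ) :
    ∑ z ∈ S with ¬ |F z - d| < ε, t z ≤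
      τ + (∑ z ∈ S, t z * F z - d + η + d * τ) / ε := by
  classical
  have hτ : 0 ≤ τ := (Finset.sum_nonneg fun z _ => ht z).trans hlow
  have key : ∀ z ∈ S, ε * (if ¬ |F z - d| < ε then t z else 0) ≤
      t z * F z - (d - η) * t z + (d + ε) * (if F z < d - η then t z else 0) := by
    intro z hz
    have h0 := ht z
    have hFz := hF z hz
    split_ifs with h1 h2 h2
    · nlinarith [mul_nonneg h0 hFz, mul_nonneg h0 hη, mul_nonneg h0 hd]
    · push Not at h2
      nlinarith [mul_nonneg h0 (sub_nonneg.2 h2)]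
    · nlinarith [mul_nonneg h0 hFz, mul_nonneg h0 hη]
    · push Not at h2
      rw [not_lt, le_abs] at h1
      rcases h1 with h1 | h1
      · nlinarith [mul_nonneg h0 hη, mul_nonneg h0 (sub_nonneg.2 h1)]
      · linarith
  have hsum := Finset.sum_le_sum key
  rw [← Finset.mul_sum, Finset.sum_add_distrib, Finset.sum_sub_distrib, ← Finset.mul_sum,
    ← Finset.mul_sum, ht1, ← Finset.sum_filter, ← Finset.sum_filter] at hsum
  have h2 : (d + ε) * ∑ z ∈ S with F z < d - η, t z ≤ (d + ε) * τ := by gcongr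
  have h3 : τ + (∑ z ∈ S, t z * F z - d + η + d * τ) / ε =
      (∑ z ∈ S, t z * F z - d + η + (d + ε) * τ) / ε := by field_simp; ring
  rw [h3, le_div_iff₀ hε, mul_comm]
  linarith

theorem monotone_finEnt_cells {θ : Measure ℝ} [IsFiniteMeasure θ] {a b : ℝ}
    (hS : ∀ᵐ x ∂θ, x ∈ Set.Icc a b) : Monotone fun J => finEnt (cells a b J) (wt θ J) := by
  intro i j hij
  obtain ⟨m, rfl⟩ := Nat.exists_eq_add_of_le hij
  have hcells : ∀ᵐ x ∂θ, dkey (i + m) x ∈ cells a b (i + m) := by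
    filter_upwards [hS] with x hx using dkey_mem_cells hx _
  exact finEnt_le_finEnt_of_fibers _ _ (fun w => w / 2 ^ m) (fun w hw => div_mem_cells hw) _
    (wt_nonneg θ _) _ fun z => wt_eq_sum_children hcells z

/-- Uniform entropy dimension follows from a lower bound for the entropy of most components
together with an upper bound for the global entropy. -/
theorem le_average_of_bounds {θ : Measure ℝ} [IsProbabilityMeasure θ] {a b : ℝ}
    (hS : ∀ᵐ x ∂θ, x ∈ Set.Icc a b) {d η τ ε : ℝ} (hε : 0 < ε) (hη : 0 ≤ η) (hηε : η < ε)
    (hd : 0 ≤ d) {n m : ℕ} (hn : 0 < n) (hm : 0 < m)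
    (hlow : ∀ i, ∑ z ∈ cells a b i with fiberEnt (cells a b (i + m)) (fun w => w / 2 ^ m)
      (wt θ (i + m)) (wt θ i) z < m * (d - η), wt θ i z ≤ τ)
    (hup : finEnt (cells a b (n + m)) (wt θ (n + m)) ≤ n * (d + η)) :
    1 - (τ + (2 * η + d * τ) / ε) ≤ (1 / (n : ℝ)) * ∑ i ∈ Finset.Icc 1 n,
      (θ {x | |(1 / (m : ℝ)) * ent1 (i + m) (dcomp θ x i) - d| < ε}).toReal := by
  classical
  have hkey : ∀ J, ∀ᵐ x ∂θ, dkey J x ∈ cells a b J := fun J => by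
    filter_upwards [hS] with x hx using dkey_mem_cells hx _
  have hsum : ∀ J, ∑ z ∈ cells a b J, wt θ J z = 1 := fun J => by
    rw [sum_wt (hkey J), probReal_univ]
  have hm' : (0 : ℝ) < m := by exact_mod_cast hm
  have hn' : (0 : ℝ) < n := by exact_mod_cast hn
  set h : ℕ → ℝ := fun J => finEnt (cells a b J) (wt θ J) with hh
  set F : ℕ → ℤ → ℝ := fun i z => (1 / (m : ℝ)) *
    fiberEnt (cells a b (i + m)) (fun w => w / 2 ^ m) (wt θ (i + m)) (wt θ i) z with hF
  have hF0 : ∀ i z, 0 ≤ F i z := fun i z => mul_nonneg (by positivity)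
    (fiberEnt_nonneg _ _ _ (wt_nonneg θ _) _ _ (wt_eq_sum_children (hkey _) z))
  have hmean : ∀ i, ∑ z ∈ cells a b i, wt θ i z * F i z = (h (i + m) - h i) / m := by
    intro i
    rw [← sum_mul_fiberEnt _ _ _ (fun w hw => div_mem_cells hw) _ (wt_nonneg θ (i + m)) _
      fun z => wt_eq_sum_children (hkey (i + m)) z, Finset.sum_div]
    refine Finset.sum_congr rfl fun z _ => ?_
    simp only [hF]
    ring
  have hmass : ∀ i, 1 - (τ + ((h (i + m) - h i) / m - d + η + d * τ) / ε) ≤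
      (θ {x | |(1 / (m : ℝ)) * ent1 (i + m) (dcomp θ x i) - d| < ε}).toReal := by
    intro i
    have h1 := measureReal_dkey (hkey i) fun z => |F i z - d| < ε
    have h2 : {x | |(1 / (m : ℝ)) * ent1 (i + m) (dcomp θ x i) - d| < ε} =
        {x | |F i (dkey i x) - d| < ε} := by
      ext x
      rw [Set.mem_ofPred_eq, Set.mem_ofPred_eq, ent1_dcomp (hkey (i + m))]
    have h3 := Finset.sum_filter_add_sum_filter_not (cells a b i) (fun z => |F i z - d| < ε)
      (wt θ i)
    rw [hsum i] at h3
    have h4 := sum_dev_le (cells a b i) (wt θ i) (F i) (wt_nonneg θ i) (hsum i)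
      (fun z _ => hF0 i z) hε hη hηε hd (τ := τ) (by
        refine le_trans (le_of_eq (Finset.sum_congr (Finset.filter_congr fun z _ => ?_)
          fun _ _ => rfl)) (hlow i)
        simp only [hF]
        rw [one_div, inv_mul_lt_iff₀ hm'])
    rw [hmean i] at h4
    rw [h2]
    change _ ≤ θ.real _
    rw [h1]
    have h5 : ∀ (A B C D : ℝ), A + B = 1 → B ≤ D → C = A → 1 - D ≤ C := by
      intro A B C D e1 e2 e3
      linarith
    refine h5 _ _ _ _ h3 h4 (Finset.sum_congr ?_ fun _ _ => rfl)
    ext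
    simp
  have htel := sum_Icc_shift_sub_le (monotone_finEnt_cells hS)
    (fun J => finEnt_nonneg _ _ (fun z _ => wt_nonneg θ J z) fun z _ => measureReal_le_one) n m
  have h6 : ∑ i ∈ Finset.Icc 1 n, (h (i + m) - h i) / m ≤ n * (d + η) := by
    rw [← Finset.sum_div, div_le_iff₀ hm']
    refine htel.trans ?_
    rw [mul_comm]
    gcongr
  have h7 := Finset.sum_le_sum fun i (_ : i ∈ Finset.Icc 1 n) => hmass i
  rw [one_div, inv_mul_eq_div, le_div_iff₀ hn']
  refine le_trans ?_ h7
  have h8 : ∑ i ∈ Finset.Icc 1 n, (1 - (τ + ((h (i + m) - h i) / m - d + η + d * τ) / ε)) =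
      n * (1 - (τ + (-d + η + d * τ) / ε)) -
        (∑ i ∈ Finset.Icc 1 n, (h (i + m) - h i) / m) / ε := by
    rw [Finset.sum_div]
    have h9 : ∀ i ∈ Finset.Icc 1 n, 1 - (τ + ((h (i + m) - h i) / m - d + η + d * τ) / ε) =
        (1 - (τ + (-d + η + d * τ) / ε)) - (h (i + m) - h i) / m / ε := fun i _ => by ring
    rw [Finset.sum_congr rfl h9, Finset.sum_sub_distrib, Finset.sum_const, Nat.card_Icc,
      nsmul_eq_mul]
    simp
  rw [h8]
  have h10 : (∑ i ∈ Finset.Icc 1 n, (h (i + m) - h i) / m) / ε ≤ n * (d + η) / ε := by gcongr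
  have h11 : (1 - (τ + (2 * η + d * τ) / ε)) * n =
      n * (1 - (τ + (-d + η + d * τ) / ε)) - n * (d + η) / ε := by ring
  linarith

theorem exists_deriv_mul_sub {f : ℝ → ℝ} (hc : ContinuousOn f unitI)
    (hd : DifferentiableOn ℝ f (Set.Ioo 0 1)) {x y : ℝ} (hx : x ∈ unitI) (hy : y ∈ unitI)
    (hxy : x ≠ y) : ∃ ξ ∈ Set.Ioo (min x y) (max x y), f x - f y = deriv f ξ * (x - y) := by
  wlog h : x < y generalizing x y
  · obtain ⟨ξ, hξ, he⟩ := this hy hx hxy.symm (lt_of_le_of_ne (not_lt.1 h) hxy.symm)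
    exact ⟨ξ, by rwa [min_comm, max_comm], by linarith⟩
  rw [min_eq_left h.le, max_eq_right h.le]
  obtain ⟨ξ, hξ, he⟩ := exists_deriv_eq_slope f h
    (hc.mono fun z hz => ⟨hx.1.trans hz.1, hz.2.trans hy.2⟩)
    (hd.mono fun z hz => ⟨hx.1.trans_lt hz.1, hz.2.trans_le hy.2⟩)
  refine ⟨ξ, hξ, ?_⟩
  rw [he]
  have : y - x ≠ 0 := by linarith
  field_simp
  ring

theorem Ioo_min_max_subset {x y : ℝ} (hx : x ∈ unitI) (hy : y ∈ unitI) :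
    Set.Ioo (min x y) (max x y) ⊆ Set.Ioo 0 1 := fun _ hz =>
  ⟨(le_min hx.1 hy.1).trans_lt hz.1, hz.2.trans_le (max_le hx.2 hy.2)⟩

theorem biLipschitz_of_derivWithin {ψ : ℝ → ℝ} (hψ : ContDiffOn ℝ 1 ψ unitI) {ε : ℝ}
    (hψ' : ∀ x ∈ unitI, ε ≤ |derivWithin ψ unitI x| ∧ |derivWithin ψ unitI x| ≤ ε⁻¹)
    {x y : ℝ} (hx : x ∈ unitI) (hy : y ∈ unitI) :
    ε * |x - y| ≤ |ψ x - ψ y| ∧ |ψ x - ψ y| ≤ ε⁻¹ * |x - y| := by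
  rcases eq_or_ne x y with rfl | hxy
  · simp
  have hsub : Set.Ioo (0 : ℝ) 1 ⊆ unitI := Ioo_subset_Icc_self
  obtain ⟨ξ, hξ, he⟩ := exists_deriv_mul_sub hψ.continuousOn
    ((hψ.differentiableOn (by norm_num)).mono hsub) hx hy hxy
  have hξ' := Ioo_min_max_subset hx hy hξ
  have h1 := hψ' ξ (hsub hξ')
  rw [derivWithin_of_mem_nhds (s := unitI) (Icc_mem_nhds hξ'.1 hξ'.2)] at h1
  rw [he, abs_mul]
  exact ⟨by gcongr; exact h1.1, by gcongr; exact h1.2⟩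

theorem exists_distortion_constants {f : ℝ → ℝ} (hf : AnalyticOnNhd ℝ f unitI)
    (hf' : ∀ x ∈ unitI, 0 < |deriv f x| ∧ |deriv f x| < 1) :
    ∃ c > 0, ∃ r < 1, ∃ L : ℝ, 0 ≤ r ∧ 0 ≤ L ∧
      (∀ x ∈ unitI, ∀ y ∈ unitI, c * |x - y| ≤ |f x - f y|) ∧
      (∀ x ∈ unitI, ∀ y ∈ unitI, |f x - f y| ≤ r * |x - y|) ∧
      (∀ ρ, ∀ x ∈ unitI, ∀ y ∈ unitI, ∀ x' ∈ unitI, ∀ y' ∈ unitI,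
        |x - x'| ≤ ρ → |x - y'| ≤ ρ → |y - x'| ≤ ρ → |y - y'| ≤ ρ →
        |f x - f y| * |x' - y'| ≤ Real.exp (L * ρ) * |f x' - f y'| * |x - y|) := by
  have hsub : Set.Ioo (0 : ℝ) 1 ⊆ unitI := Ioo_subset_Icc_self
  have hI : IsCompact unitI := isCompact_Icc
  have hne : unitI.Nonempty := ⟨0, le_rfl, zero_le_one⟩
  obtain ⟨x₁, hx₁, hmin⟩ := hI.exists_isMinOn hne hf.deriv.continuousOn.abs
  obtain ⟨x₂, hx₂, hmax⟩ := hI.exists_isMaxOn hne hf.deriv.continuousOn.abs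
  obtain ⟨x₃, hx₃, hmax'⟩ := hI.exists_isMaxOn hne hf.deriv.deriv.continuousOn.abs
  set c := |deriv f x₁| with hc
  set r := |deriv f x₂| with hr
  set M := |deriv (deriv f) x₃| with hM
  have hc0 : 0 < c := (hf' x₁ hx₁).1
  have hmvt := fun {x y : ℝ} (hx : x ∈ unitI) (hy : y ∈ unitI) (hxy : x ≠ y) =>
    exists_deriv_mul_sub hf.continuousOn (hf.differentiableOn.mono hsub) hx hy hxy
  refine ⟨c, hc0, r, (hf' x₂ hx₂).2, M / c, abs_nonneg _, by positivity, fun x hx y hy => ?_,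
    fun x hx y hy => ?_, fun ρ x hx y hy x' hx' y' hy' h1 h2 h3 h4 => ?_⟩
  · rcases eq_or_ne x y with rfl | hxy
    · simp
    obtain ⟨ξ, hξ, he⟩ := hmvt hx hy hxy
    rw [he, abs_mul]
    gcongr
    exact hmin (hsub (Ioo_min_max_subset hx hy hξ))
  · rcases eq_or_ne x y with rfl | hxy
    · simp
    obtain ⟨ξ, hξ, he⟩ := hmvt hx hy hxy
    rw [he, abs_mul]
    gcongr
    exact hmax (hsub (Ioo_min_max_subset hx hy hξ))
  · rcases eq_or_ne x y with rfl | hxy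
    · simp
    rcases eq_or_ne x' y' with rfl | hxy'
    · simp
    obtain ⟨ξ, hξ, he⟩ := hmvt hx hy hxy
    obtain ⟨ξ', hξ', he'⟩ := hmvt hx' hy' hxy'
    have hξI := hsub (Ioo_min_max_subset hx hy hξ)
    have hξI' := hsub (Ioo_min_max_subset hx' hy' hξ')
    have hρ : |ξ - ξ'| ≤ ρ := by
      rw [abs_le] at *
      have u1 : max x y - min x' y' ≤ ρ := by
        rcases max_choice x y with e | e <;> rcases min_choice x' y' with e' | e' <;>
          rw [e, e'] <;> linarith [h1.2, h2.2, h3.2, h4.2]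
      have u2 : max x' y' - min x y ≤ ρ := by
        rcases min_choice x y with e | e <;> rcases max_choice x' y' with e' | e' <;>
          rw [e, e'] <;> linarith [h1.1, h2.1, h3.1, h4.1]
      constructor <;> linarith [hξ.1, hξ.2, hξ'.1, hξ'.2]
    have hlip : |deriv f ξ - deriv f ξ'| ≤ M * |ξ - ξ'| :=
      (convex_Icc (0 : ℝ) 1).norm_image_sub_le_of_norm_deriv_le (f := deriv f)
        (fun z hz => (hf.deriv z hz).differentiableAt)
        (fun z hz => hmax' hz) hξI' hξI
    have hcξ : c ≤ |deriv f ξ'| := hmin hξI'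
    have hratio : |deriv f ξ| ≤ Real.exp (M / c * ρ) * |deriv f ξ'| := by
      have hM0 : 0 ≤ M := abs_nonneg _
      have hρ0 : 0 ≤ ρ := (abs_nonneg _).trans hρ
      calc |deriv f ξ| ≤ |deriv f ξ - deriv f ξ'| + |deriv f ξ'| := by
            have := abs_add_le (deriv f ξ - deriv f ξ') (deriv f ξ')
            rwa [sub_add_cancel] at this
        _ ≤ M * ρ + |deriv f ξ'| := by
            gcongr
            exact hlip.trans (by gcongr)
        _ = M / c * ρ * c + |deriv f ξ'| := by field_simp
        _ ≤ M / c * ρ * |deriv f ξ'| + |deriv f ξ'| := by gcongr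
        _ = (M / c * ρ + 1) * |deriv f ξ'| := by ring
        _ ≤ Real.exp (M / c * ρ) * |deriv f ξ'| := by
            gcongr
            exact Real.add_one_le_exp _
    rw [he, he', abs_mul, abs_mul]
    calc |deriv f ξ| * |x - y| * |x' - y'|
        ≤ Real.exp (M / c * ρ) * |deriv f ξ'| * |x - y| * |x' - y'| := by gcongr
      _ = _ := by ring

/-- Bi-Lipschitz images of a self-conformal measure are spread out at every scale. -/
theorem spread_map_of_selfConformal {Λ : Type*} [Fintype Λ] [Nonempty Λ] {f : Λ → ℝ → ℝ}
    {c₀ r L : ℝ} (hf : ∀ i, MapsTo (f i) unitI unitI) (hfm : ∀ i, Measurable (f i))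
    (hc₀ : 0 < c₀) (hr : 0 ≤ r) (hr1 : r < 1) (hL : 0 ≤ L)
    (hlo : ∀ i, ∀ x ∈ unitI, ∀ y ∈ unitI, c₀ * |x - y| ≤ |f i x - f i y|)
    (hup : ∀ i, ∀ x ∈ unitI, ∀ y ∈ unitI, |f i x - f i y| ≤ r * |x - y|)
    (hdist : ∀ i ρ, ∀ x ∈ unitI, ∀ y ∈ unitI, ∀ x' ∈ unitI, ∀ y' ∈ unitI,
      |x - x'| ≤ ρ → |x - y'| ≤ ρ → |y - x'| ≤ ρ → |y - y'| ≤ ρ →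
      |f i x - f i y| * |x' - y'| ≤ Real.exp (L * ρ) * |f i x' - f i y'| * |x - y|)
    {K : ℝ} (hK : K = Real.exp (L / (1 - r)))
    {μ : Measure ℝ} [IsProbabilityMeasure μ] (hμI : μ unitIᶜ = 0) {w : Λ → ENNReal}
    (hμ : μ = ∑ i, w i • μ.map (f i))
    {E : Set ℝ} (hE : MeasurableSet E) {δ κ : ENNReal} (hμE : μ Eᶜ ≤ δ) {c k : ℕ}
    (hreg : ∀ x ∈ E, μ (Metric.closedBall x ((1 / 2) ^ k)) ≤ κ)
    {ψ : ℝ → ℝ} (hψ : Measurable ψ) {ε : ℝ} (hε : 0 < ε)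
    (hψ' : ∀ x ∈ unitI, ∀ y ∈ unitI,
      ε * |x - y| ≤ |ψ x - ψ y| ∧ |ψ x - ψ y| ≤ ε⁻¹ * |x - y|)
    (hc : (K + K ^ 2 / c₀) * ε⁻¹ ≤ 2 ^ c) (i : ℕ) :
    Spread δ κ (i + (c + k)) (2 ^ (c + 1) / 2 ^ i) (μ.map ψ) := by
  have hK0 : 0 < K := hK ▸ Real.exp_pos _
  have hε' : 0 < ε⁻¹ := inv_pos.2 hε
  have hA : K * ε⁻¹ ≤ 2 ^ c := by
    refine le_trans ?_ hc
    gcongr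
    exact le_add_of_nonneg_right (by positivity)
  have hB : K ^ 2 / c₀ * ε⁻¹ ≤ 2 ^ c := by
    refine le_trans ?_ hc
    gcongr
    exact le_add_of_nonneg_left hK0.le
  refine stopping_induction (f := f) (t := 1 / 2 ^ i)
    (P := fun g => Measurable g →
      Spread δ κ (i + (c + k)) (2 ^ (c + 1) / 2 ^ i) (μ.map (ψ ∘ g)))
    hf hfm hc₀ hr hr1 hL hlo hup hdist hK (by positivity)
    (div_le_one_of_le₀ (one_le_pow₀ (by norm_num)) (by positivity)) ?_ ?_ measurable_id
  · intro g hg hgm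
    have h1 : μ.map (ψ ∘ g) = ∑ j, w j • μ.map (ψ ∘ (g ∘ f j)) := by
      conv_lhs => rw [hμ]
      ext s hs
      have hm : Measurable (ψ ∘ g) := hψ.comp hgm
      rw [Measure.map_apply hm hs]
      simp only [Measure.coe_finsetSum, Finset.sum_apply, Measure.smul_apply, smul_eq_mul]
      refine Finset.sum_congr rfl fun j _ => ?_
      rw [Measure.map_apply (hfm j) (hm hs), Measure.map_apply (hψ.comp (hgm.comp (hfm j))) hs]
      rfl
    rw [h1]
    exact Spread.sum (fun j => hg j (hgm.comp (hfm j))) w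
  · intro g hgm hgI h1 h2 _
    refine spread_map hμI hE hμE hreg (hψ.comp hgm) (fun x hx y hy => ?_) fun x hx y hy => ?_
    · have h3 := (hψ' _ (hgI hx) _ (hgI hy)).1
      simp only [Function.comp_apply]
      calc |x - y| = K ^ 2 / c₀ * 2 ^ i * (c₀ / K ^ 2 * (1 / 2 ^ i) * |x - y|) := by
            field_simp
        _ ≤ K ^ 2 / c₀ * 2 ^ i * |g x - g y| := by
            gcongr
            exact h1 x hx y hy
        _ = K ^ 2 / c₀ * ε⁻¹ * 2 ^ i * (ε * |g x - g y|) := by field_simp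
        _ ≤ 2 ^ c * 2 ^ i * |ψ (g x) - ψ (g y)| := by gcongr
        _ = 2 ^ (c + i) * |ψ (g x) - ψ (g y)| := by rw [pow_add]
    · have h3 := (hψ' _ (hgI hx) _ (hgI hy)).2
      simp only [Function.comp_apply]
      calc |ψ (g x) - ψ (g y)| ≤ ε⁻¹ * |g x - g y| := h3
        _ ≤ ε⁻¹ * (K * (1 / 2 ^ i) * |x - y|) := by
            gcongr
            exact h2 x hx y hy
        _ = K * ε⁻¹ / 2 ^ i * |x - y| := by ring
        _ ≤ 2 ^ c / 2 ^ i * |x - y| := by gcongr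

/-- A function on the unit interval, extended to the line by constants. -/
def extendI (f : ℝ → ℝ) (x : ℝ) : ℝ := f (Set.projIcc (0 : ℝ) 1 zero_le_one x)

theorem extendI_eqOn (f : ℝ → ℝ) : EqOn (extendI f) f unitI := fun x hx => by
  rw [extendI, Set.projIcc_of_mem zero_le_one hx]

theorem measurable_extendI {f : ℝ → ℝ} (hf : ContinuousOn f unitI) : Measurable (extendI f) := by
  refine (hf.comp_continuous (continuous_subtype_val.comp continuous_projIcc) fun x => ?_).measurable
  exact (Set.projIcc (0 : ℝ) 1 zero_le_one x).2

theorem map_extendI {μ : Measure ℝ} (hμI : μ unitIᶜ = 0) (f : ℝ → ℝ) :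
    μ.map (extendI f) = μ.map f := by
  refine Measure.map_congr ?_
  have : ∀ᵐ x ∂μ, x ∈ unitI := by rwa [ae_iff]
  filter_upwards [this] with x hx using extendI_eqOn f hx

/-- A finite family of analytic contractions without critical points has uniform bi-Lipschitz and
distortion constants. -/
theorem exists_uniform_distortion_constants {Λ : Type*} [Finite Λ] [Nonempty Λ] {φ : Λ → ℝ → ℝ}
    (hφ : ∀ i, AnalyticOnNhd ℝ (φ i) unitI)
    (hφ' : ∀ i, ∀ x ∈ unitI, 0 < |deriv (φ i) x| ∧ |deriv (φ i) x| < 1) :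
    ∃ c > 0, ∃ r < 1, ∃ L : ℝ, 0 ≤ r ∧ 0 ≤ L ∧
      (∀ i, ∀ x ∈ unitI, ∀ y ∈ unitI, c * |x - y| ≤ |φ i x - φ i y|) ∧
      (∀ i, ∀ x ∈ unitI, ∀ y ∈ unitI, |φ i x - φ i y| ≤ r * |x - y|) ∧
      (∀ i ρ, ∀ x ∈ unitI, ∀ y ∈ unitI, ∀ x' ∈ unitI, ∀ y' ∈ unitI,
        |x - x'| ≤ ρ → |x - y'| ≤ ρ → |y - x'| ≤ ρ → |y - y'| ≤ ρ →
        |φ i x - φ i y| * |x' - y'| ≤ Real.exp (L * ρ) * |φ i x' - φ i y'| * |x - y|) := by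
  choose c hc r hr L hr0 hL hlo hup hdist using fun i => exists_distortion_constants (hφ i) (hφ' i)
  obtain ⟨i₁, h₁⟩ := Finite.exists_min c
  obtain ⟨i₂, h₂⟩ := Finite.exists_max r
  obtain ⟨i₃, h₃⟩ := Finite.exists_max L
  refine ⟨c i₁, hc i₁, r i₂, hr i₂, L i₃, hr0 i₂, hL i₃, fun i x hx y hy => ?_,
    fun i x hx y hy => ?_, fun i ρ x hx y hy x' hx' y' hy' a1 a2 a3 a4 => ?_⟩
  · refine le_trans ?_ (hlo i x hx y hy)
    gcongr
    exact h₁ i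
  · refine (hup i x hx y hy).trans ?_
    gcongr
    exact h₂ i
  · have hρ : 0 ≤ ρ := (abs_nonneg _).trans a1
    refine (hdist i ρ x hx y hy x' hx' y' hy' a1 a2 a3 a4).trans ?_
    gcongr
    exact h₃ i

/-- The component entropies of a measure with dimension approximately `d` at scale `2⁻ᵏ` which is
spread out at all scales are rarely much smaller than `m * d`. -/
theorem sum_low_fiberEnt_le_of_spread {θ : Measure ℝ} [IsProbabilityMeasure θ] {a b : ℝ}
    (hS : ∀ᵐ x ∂θ, x ∈ Set.Icc a b) {d η τ s δ δ' B : ℝ} {c k i : ℕ}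
    (hδ : 0 ≤ δ) (hδη : δ ≤ η / 8) (hs : 0 < s) (hs1 : s ≤ 1) (hsd : s * d ≤ η / 4)
    (hδ' : 0 < δ') (hB : B = Real.logb 2 (2 / δ'))
    (hτ : (2 * δ + δ' * (2 * 2 ^ (c + 1) + 1)) / s ≤ τ)
    (hk : 2 * |B| + c * d ≤ k * (η / 2))
    (hθ : Spread (ENNReal.ofReal δ) (ENNReal.ofReal ((2 : ℝ) ^ (-(k * (d - δ)))))
      (i + (c + k)) (2 ^ (c + 1) / 2 ^ i) θ) :
    ∑ z ∈ cells a b i with fiberEnt (cells a b (i + (c + k))) (fun w => w / 2 ^ (c + k))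
      (wt θ (i + (c + k))) (wt θ i) z < ((c + k : ℕ) : ℝ) * (d - η), wt θ i z ≤ τ := by
  have hlog : -Real.logb 2 (2 * (2 : ℝ) ^ (-(k * (d - δ))) / δ') = k * (d - δ) - B := by
    rw [hB, mul_div_right_comm, Real.logb_mul (by positivity) (by positivity),
      Real.logb_rpow (by norm_num) (by norm_num)]
    ring
  have h1 := Spread.sum_low_le (κ := (2 : ℝ) ^ (-(k * (d - δ)))) (L := 2 ^ (c + 1)) (i := i)
    (m := c + k) hδ (by positivity) (by push_cast; exact hθ) hS hδ' hs hs1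
  rw [hlog] at h1
  push_cast at h1 ⊢
  refine le_trans (Finset.sum_le_sum_of_subset_of_nonneg ?_ fun z _ _ => wt_nonneg θ i z)
    (h1.trans hτ)
  refine Finset.monotone_filter_right _ fun z _ hz => hz.trans_le ?_
  have hη : 0 ≤ η := by linarith
  have hk0 : (0 : ℝ) ≤ k := k.cast_nonneg
  have e1 : k * δ ≤ k * (η / 8) := by gcongr
  have e2 : k * (s * d) ≤ k * (η / 4) := by gcongr
  have e3 : 0 ≤ k * (s * δ) := by positivity
  have e4 : -(2 * |B|) ≤ -(1 - s) * B := by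
    have : |(1 - s) * B| ≤ 1 * |B| := by
      rw [abs_mul, abs_of_nonneg (by linarith : 0 ≤ 1 - s)]
      gcongr
      linarith
    linarith [le_abs_self ((1 - s) * B), abs_nonneg B]
  have e5 : 0 ≤ (c : ℝ) * η := by positivity
  have e6 : 0 ≤ (k : ℝ) * η := by positivity
  linarith

theorem uniform_entropy_dimension
    {Λ : Type} [Fintype Λ] [Nonempty Λ]
    (φ : Λ → ℝ → ℝ)
    (hanal : ∀ i, AnalyticOnNhd ℝ (φ i) unitI)
    (hmaps : ∀ i, Set.MapsTo (φ i) unitI unitI)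
    (hderiv : ∀ i, ∀ x ∈ unitI, 0 < |deriv (φ i) x| ∧ |deriv (φ i) x| < 1)
    (hnofix : ¬ ∃ x ∈ unitI, ∀ i, φ i x = x)
    (p : Λ → ℝ) (hp : ∀ i, 0 < p i) (hp1 : ∑ i, p i = 1)
    (μ : Measure ℝ) (hprob : IsProbabilityMeasure μ) (hμI : μ unitIᶜ = 0)
    (hμ : μ = ∑ i : Λ, ENNReal.ofReal (p i) • Measure.map (φ i) μ)
    (dμ : ℝ) (hdim : ExactDimWith μ dμ) :
    ∀ ε : ℝ, 0 < ε → ε < 1 →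
      ∃ M : ℕ, 1 ≤ M ∧ ∀ m : ℕ, M ≤ m →
        ∃ N : ℕ, 1 ≤ N ∧ ∀ n : ℕ, N ≤ n →
          ∀ ψ : ℝ → ℝ, ContDiffOn ℝ 1 ψ unitI →
            (∀ x ∈ unitI, ε ≤ |derivWithin ψ unitI x| ∧ |derivWithin ψ unitI x| ≤ ε⁻¹) →
            1 - ε < (1 / (n : ℝ)) * ∑ i ∈ Finset.Icc 1 n,
              ((μ.map ψ) {x | |(1 / (m : ℝ)) * ent1 (i + m) (dcomp (μ.map ψ) x i) - dμ| < ε}).toReal := by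
  intro ε hε hε1
  obtain ⟨c₀, hc₀, r, hr1, L, hr0, hL, hlo, hup, hdist⟩ :=
    exists_uniform_distortion_constants hanal hderiv
  have heq := fun i => extendI_eqOn (φ i)
  have hF : ∀ i, MapsTo (extendI (φ i)) unitI unitI := fun i => (hmaps i).congr (heq i).symm
  have hFm : ∀ i, Measurable (extendI (φ i)) := fun i =>
    measurable_extendI (hanal i).continuousOn
  have hFlo : ∀ i, ∀ x ∈ unitI, ∀ y ∈ unitI,
      c₀ * |x - y| ≤ |extendI (φ i) x - extendI (φ i) y| := fun i x hx y hy => by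
    rw [heq i hx, heq i hy]
    exact hlo i x hx y hy
  have hFup : ∀ i, ∀ x ∈ unitI, ∀ y ∈ unitI,
      |extendI (φ i) x - extendI (φ i) y| ≤ r * |x - y| := fun i x hx y hy => by
    rw [heq i hx, heq i hy]
    exact hup i x hx y hy
  have hFdist : ∀ i ρ, ∀ x ∈ unitI, ∀ y ∈ unitI, ∀ x' ∈ unitI, ∀ y' ∈ unitI,
      |x - x'| ≤ ρ → |x - y'| ≤ ρ → |y - x'| ≤ ρ → |y - y'| ≤ ρ →
      |extendI (φ i) x - extendI (φ i) y| * |x' - y'| ≤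
        Real.exp (L * ρ) * |extendI (φ i) x' - extendI (φ i) y'| * |x - y| := by
    intro i ρ x hx y hy x' hx' y' hy'
    rw [heq i hx, heq i hy, heq i hx', heq i hy']
    exact hdist i ρ x hx y hy x' hx' y' hy'
  have hFμ : μ = ∑ i, ENNReal.ofReal (p i) • μ.map (extendI (φ i)) := by
    simp only [map_extendI hμI]
    exact hμ
  set K := Real.exp (L / (1 - r)) with hK
  have hK0 : 0 < K := Real.exp_pos _
  have hd : 0 ≤ dμ := hdim.nonneg
  obtain ⟨c, hc⟩ := pow_unbounded_of_one_lt ((K + K ^ 2 / c₀) * ε⁻¹ + ε⁻¹)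
    (by norm_num : (1 : ℝ) < 2)
  have hεi : 0 < ε⁻¹ := inv_pos.2 hε
  have hc1 : (K + K ^ 2 / c₀) * ε⁻¹ ≤ 2 ^ c := by linarith
  have hc2 : ε⁻¹ ≤ 2 ^ c := by
    have : 0 < (K + K ^ 2 / c₀) * ε⁻¹ := by positivity
    linarith
  set η := ε ^ 2 / 8 with hη
  set τ := ε ^ 2 / (4 * (dμ + 1)) with hτ
  set s := η / (4 * (dμ + 1)) with hs
  set A : ℝ := 2 * 2 ^ (c + 1) + 1 with hA
  set δ := min (η / 8) (s * τ / 4) with hδ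
  set δ' := s * τ / (2 * A) with hδ'
  set B := Real.logb 2 (2 / δ') with hB
  have hη0 : 0 < η := by positivity
  have hτ0 : 0 < τ := by positivity
  have hs0 : 0 < s := by positivity
  have hA0 : 0 < A := by positivity
  have hδ0 : 0 < δ := lt_min (by positivity) (by positivity)
  have hδ'0 : 0 < δ' := by positivity
  have hδη : δ ≤ η / 8 := min_le_left _ _
  have hηε : η < ε := by
    rw [hη]
    nlinarith
  have hs1 : s ≤ 1 := by
    rw [hs, div_le_one (by positivity)]
    nlinarith
  have hsd : s * dμ ≤ η / 4 := by
    rw [hs, div_mul_eq_mul_div, div_le_div_iff₀ (by positivity) (by norm_num)]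
    nlinarith
  have hlowτ : (2 * δ + δ' * A) / s ≤ τ := by
    rw [div_le_iff₀ hs0]
    have h1 : δ' * A = s * τ / 2 := by
      rw [hδ']
      field_simp
    have h2 : δ ≤ s * τ / 4 := min_le_right _ _
    linarith
  have hfin : τ + (2 * η + dμ * τ) / ε < ε := by
    have h1 : (dμ + 1) * τ = ε ^ 2 / 4 := by
      rw [hτ]
      field_simp
    have h2 : τ * ε ≤ τ := mul_le_of_le_one_right hτ0.le hε1.le
    rw [← lt_sub_iff_add_lt', div_lt_iff₀ hε]
    nlinarith
  obtain ⟨E, hE, hμE, k₀, hreg⟩ := hdim.exists_regular_set hδ0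
  obtain ⟨k₁, hk₁⟩ := exists_nat_ge ((2 * |B| + c * dμ) / (η / 2))
  refine ⟨c + (k₀ + k₁) + 1, by omega, fun m hm => ?_⟩
  obtain ⟨k, rfl⟩ := Nat.exists_eq_add_of_le (show c ≤ m by omega)
  have hk : 2 * |B| + c * dμ ≤ k * (η / 2) := by
    rw [← div_le_iff₀ (by positivity)]
    exact hk₁.trans (by exact_mod_cast (show k₁ ≤ k by omega))
  set m := c + k with hmdef
  obtain ⟨N, hN⟩ := exists_nat_ge
    ((Real.logb 2 6 + (m + c) * (dμ + δ) + δ * (m + c + 3)) / (η / 2))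
  rw [div_le_iff₀ (by positivity)] at hN
  refine ⟨N + 1, by omega, fun n hn ψ hψ hψ' => ?_⟩
  have hψeq := extendI_eqOn ψ
  have hψm : Measurable (extendI ψ) := measurable_extendI hψ.continuousOn
  have hbi : ∀ x ∈ unitI, ∀ y ∈ unitI, ε * |x - y| ≤ |extendI ψ x - extendI ψ y| ∧
      |extendI ψ x - extendI ψ y| ≤ ε⁻¹ * |x - y| := by
    intro x hx y hy
    rw [hψeq hx, hψeq hy]
    exact biLipschitz_of_derivWithin hψ hψ' hx hy
  have hlip : ∀ x ∈ unitI, ∀ y ∈ unitI, |extendI ψ x - extendI ψ y| ≤ 2 ^ c * |x - y| :=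
    fun x hx y hy => (hbi x hx y hy).2.trans (by gcongr)
  rw [← map_extendI hμI ψ]
  set θ := μ.map (extendI ψ) with hθ
  have : IsProbabilityMeasure θ := Measure.isProbabilityMeasure_map hψm.aemeasurable
  set a := extendI ψ 0 - 2 ^ c with ha
  set b := extendI ψ 0 + 2 ^ c with hb
  have hψI : MapsTo (extendI ψ) unitI (Set.Icc a b) := by
    intro x hx
    have h1 := hlip x hx 0 ⟨le_rfl, zero_le_one⟩
    have h2 : (2 : ℝ) ^ c * |x - 0| ≤ 2 ^ c * 1 := by
      gcongr
      rw [sub_zero, abs_of_nonneg hx.1]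
      exact hx.2
    have h3 := abs_le.1 (h1.trans h2)
    constructor <;> linarith
  have hS : ∀ᵐ x ∂θ, x ∈ Set.Icc a b := by
    refine (ae_map_iff hψm.aemeasurable (p := fun x => x ∈ Set.Icc a b) measurableSet_Icc).2 ?_
    have hI : ∀ᵐ x ∂μ, x ∈ unitI := by rwa [ae_iff]
    filter_upwards [hI] with x hx using hψI hx
  refine lt_of_lt_of_le ?_ (le_average_of_bounds (a := a) (b := b) (η := η) (τ := τ) hS hε hη0.le
    hηε hd (by omega) (by omega) (fun i => ?_) ?_)
  · linarith
  · refine sum_low_fiberEnt_le_of_spread hS hδ0.le hδη hs0 hs1 hsd hδ'0 hB hlowτ hk ?_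
    refine spread_map_of_selfConformal hF hFm hc₀ hr0 hr1 hL hFlo hFup hFdist hK hμI hFμ hE hμE
      (fun x hx => ?_) hψm hε hbi hc1 i
    rw [ENNReal.le_ofReal_iff_toReal_le (measure_ne_top _ _) (by positivity)]
    exact (hreg k (by omega) x hx).2
  · refine (finEnt_map_le (D := dμ + δ) (c := c) hμI hE hδ0.le (by linarith) hμE (fun x hx => ?_)
      hψm hlip ?_ hψI).trans ?_
    · exact (hreg _ (by omega) x hx).1
    · rw [ha, hb, pow_succ]
      linarith
    · have hnN : (N : ℝ) ≤ n := by exact_mod_cast (show N ≤ n by omega)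
      have e1 : (N : ℝ) * (η / 2) ≤ n * (η / 2) := by gcongr
      have e2 : (n : ℝ) * δ ≤ n * (η / 8) := by gcongr
      push_cast at hN e1 ⊢
      have e3 : (0 : ℝ) ≤ n * η := by positivity
      linarith
end
end

section
/- Let Φ={φ_i}_{i∈Λ} be an analytic IFS on I=[0,1] with 0<|φ_i'(x)|<1 for all i∈Λ and x∈I, whose maps have no common fixed point, let p be a positive probability vector and μ the associated self-conformal measure. For every 0<ε<1 there exists δ>0 such that for every C¹ map ψ:I→ℝ with ε ≤ |ψ'(x)| ≤ ε^{-1} for all x∈I, one has ψμ(B(x,δr)) ≤ ε·ψμ(B(x,r)) for every x∈ℝ and every 0<r<1. -/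
open MeasureTheory Filter Set Metric Topology

noncomputable section

/-- Mean value theorem on the unit interval. -/
lemma exists_sub_eq_deriv_mul {g g' : ℝ → ℝ}
    (hg : ∀ x ∈ unitI, HasDerivWithinAt g (g' x) unitI x) {x y : ℝ}
    (hx : x ∈ unitI) (hy : y ∈ unitI) : ∃ c ∈ unitI, g x - g y = g' c * (x - y) := by
  wlog hxy : y < x generalizing x y
  · rcases (not_lt.1 hxy).eq_or_lt with rfl | h
    · exact ⟨x, hx, by simp⟩
    · obtain ⟨c, hc, h'⟩ := this hy hx h
      exact ⟨c, hc, by linear_combination -h'⟩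
  · have hsub : Icc y x ⊆ unitI := Icc_subset_Icc hy.1 hx.2
    obtain ⟨c, hc, h⟩ := exists_hasDerivAt_eq_slope g g' hxy
      (fun z hz => ((hg z (hsub hz)).continuousWithinAt).mono hsub)
      (fun z hz => (hg z (hsub (Ioo_subset_Icc_self hz))).hasDerivAt
        (mem_of_superset (Icc_mem_nhds hz.1 hz.2) hsub))
    refine ⟨c, hsub (Ioo_subset_Icc_self hc), ?_⟩
    rw [h, div_mul_cancel₀ _ (sub_pos.2 hxy).ne']

lemma abs_sub_le_of_deriv_le {g g' : ℝ → ℝ} {C : ℝ}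
    (hg : ∀ x ∈ unitI, HasDerivWithinAt g (g' x) unitI x) (hC : ∀ x ∈ unitI, |g' x| ≤ C)
    {x y : ℝ} (hx : x ∈ unitI) (hy : y ∈ unitI) : |g x - g y| ≤ C * |x - y| := by
  obtain ⟨c, hc, h⟩ := exists_sub_eq_deriv_mul hg hx hy
  rw [h, abs_mul]
  exact mul_le_mul_of_nonneg_right (hC c hc) (abs_nonneg _)

lemma le_abs_sub_of_le_deriv {g g' : ℝ → ℝ} {C : ℝ}
    (hg : ∀ x ∈ unitI, HasDerivWithinAt g (g' x) unitI x) (hC : ∀ x ∈ unitI, C ≤ |g' x|)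
    {x y : ℝ} (hx : x ∈ unitI) (hy : y ∈ unitI) : C * |x - y| ≤ |g x - g y| := by
  obtain ⟨c, hc, h⟩ := exists_sub_eq_deriv_mul hg hx hy
  rw [h, abs_mul]
  exact mul_le_mul_of_nonneg_right (hC c hc) (abs_nonneg _)

lemma abs_sub_le_one {x y : ℝ} (hx : x ∈ unitI) (hy : y ∈ unitI) : |x - y| ≤ 1 :=
  abs_sub_le_iff.2 ⟨by linarith [hx.2, hy.1], by linarith [hx.1, hy.2]⟩

/-- `g` has nonvanishing derivative `g'` on the unit interval, and the logarithm of `|g'|` is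
`K`-Lipschitz there. -/
structure HasBoundedDistortion (K : ℝ) (g g' : ℝ → ℝ) : Prop where
  hasDerivWithinAt : ∀ x ∈ unitI, HasDerivWithinAt g (g' x) unitI x
  deriv_ne_zero : ∀ x ∈ unitI, g' x ≠ 0
  log_sub_le : ∀ x ∈ unitI, ∀ y ∈ unitI, |Real.log (g' x) - Real.log (g' y)| ≤ K * |x - y|

namespace HasBoundedDistortion

lemma continuousOn {K : ℝ} {g g' : ℝ → ℝ} (h : HasBoundedDistortion K g g') :
    ContinuousOn g unitI :=
  fun x hx => (h.hasDerivWithinAt x hx).continuousWithinAt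

lemma id {K : ℝ} (hK : 0 ≤ K) : HasBoundedDistortion K id (fun _ => 1) where
  hasDerivWithinAt x _ := hasDerivWithinAt_id x _
  deriv_ne_zero _ _ := one_ne_zero
  log_sub_le x _ y _ := by simpa using mul_nonneg hK (abs_nonneg (x - y))

lemma comp {K L ρ : ℝ} {g g' f f' : ℝ → ℝ} (hg : HasBoundedDistortion K g g')
    (hf : HasBoundedDistortion L f f') (hmaps : MapsTo f unitI unitI)
    (hρ : ∀ x ∈ unitI, |f' x| ≤ ρ) (hK : 0 ≤ K) (hKL : L + K * ρ ≤ K) :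
    HasBoundedDistortion K (g ∘ f) (fun x => g' (f x) * f' x) where
  hasDerivWithinAt x hx :=
    (hg.hasDerivWithinAt _ (hmaps hx)).comp x (hf.hasDerivWithinAt x hx) hmaps
  deriv_ne_zero x hx := mul_ne_zero (hg.deriv_ne_zero _ (hmaps hx)) (hf.deriv_ne_zero x hx)
  log_sub_le x hx y hy := by
    rw [Real.log_mul (hg.deriv_ne_zero _ (hmaps hx)) (hf.deriv_ne_zero x hx),
      Real.log_mul (hg.deriv_ne_zero _ (hmaps hy)) (hf.deriv_ne_zero y hy)]
    have h1 := hg.log_sub_le _ (hmaps hx) _ (hmaps hy)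
    have h2 := hf.log_sub_le _ hx _ hy
    have h3 := mul_le_mul_of_nonneg_left
      (abs_sub_le_of_deriv_le hf.hasDerivWithinAt hρ hx hy) hK
    have h4 := mul_le_mul_of_nonneg_right hKL (abs_nonneg (x - y))
    rw [add_sub_add_comm]
    refine (abs_add_le _ _).trans ?_
    linarith

lemma exp_neg_mul_le {K : ℝ} {g g' : ℝ → ℝ} (h : HasBoundedDistortion K g g') (hK : 0 ≤ K)
    {x y : ℝ} (hx : x ∈ unitI) (hy : y ∈ unitI) : Real.exp (-K) * |g' x| ≤ |g' y| := by
  rw [← Real.exp_log_eq_abs (h.deriv_ne_zero x hx), ← Real.exp_log_eq_abs (h.deriv_ne_zero y hy),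
    ← Real.exp_add, Real.exp_le_exp]
  have h1 := (abs_le.1 (h.log_sub_le x hx y hy)).2
  have h2 := mul_le_mul_of_nonneg_left (abs_sub_le_one hx hy) hK
  linarith

end HasBoundedDistortion

/-- An analytic map of the unit interval with nonvanishing derivative has bounded distortion. -/
lemma AnalyticOnNhd.exists_hasBoundedDistortion {f : ℝ → ℝ} (hf : AnalyticOnNhd ℝ f unitI)
    (h0 : ∀ x ∈ unitI, deriv f x ≠ 0) : ∃ L, HasBoundedDistortion L f (deriv f) := by
  have hd : ∀ x ∈ unitI, HasDerivWithinAt (fun x => Real.log (deriv f x))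
      (deriv (deriv f) x / deriv f x) unitI x := fun x hx =>
    ((hf.deriv x hx).differentiableAt.hasDerivAt.log (h0 x hx)).hasDerivWithinAt
  have hc : ContinuousOn (fun x => deriv (deriv f) x / deriv f x) unitI :=
    hf.deriv.deriv.continuousOn.div hf.deriv.continuousOn h0
  obtain ⟨L, hL⟩ := (isCompact_Icc : IsCompact unitI).exists_bound_of_continuousOn hc
  exact ⟨L, fun x hx => (hf x hx).differentiableAt.hasDerivAt.hasDerivWithinAt, h0,
    fun x hx y hy => abs_sub_le_of_deriv_le hd hL hx hy⟩

section SelfConformal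

variable {Λ : Type*} [Fintype Λ] {φ : Λ → ℝ → ℝ} {p : Λ → ℝ} {μ : Measure ℝ}

lemma measure_inter_unitI (hμI : μ unitIᶜ = 0) (S : Set ℝ) : μ (unitI ∩ S) = μ S :=
  Measure.measure_inter_eq_of_ae (mem_ae_iff.2 hμI)

lemma aemeasurable_of_continuousOn_unitI (hμI : μ unitIᶜ = 0) {g : ℝ → ℝ}
    (hg : ContinuousOn g unitI) : AEMeasurable g μ := by
  rw [← Measure.restrict_eq_self_of_ae_mem (s := unitI) (μ := μ) (mem_ae_iff.2 hμI)]
  exact hg.aemeasurable measurableSet_Icc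

lemma measure_eq_sum_preimage (hμI : μ unitIᶜ = 0) (hφ : ∀ i, ContinuousOn (φ i) unitI)
    (hμ : μ = ∑ i : Λ, ENNReal.ofReal (p i) • Measure.map (φ i) μ)
    {S : Set ℝ} (hS : MeasurableSet S) :
    μ S = ∑ i, ENNReal.ofReal (p i) * μ (unitI ∩ φ i ⁻¹' S) := by
  conv_lhs => rw [hμ]
  rw [Measure.finsetSum_apply]
  refine Finset.sum_congr rfl fun i _ => ?_
  rw [Measure.smul_apply, smul_eq_mul, measure_inter_unitI hμI,
    Measure.map_apply_of_aemeasurable (aemeasurable_of_continuousOn_unitI hμI (hφ i)) hS]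

lemma finite_setOf_le_measure_singleton [IsFiniteMeasure μ] {a : ℝ} (ha : μ {a} ≠ 0) :
    {x : ℝ | μ {a} ≤ μ {x}}.Finite :=
  Measure.finite_const_le_meas_of_disjoint_iUnion μ (pos_iff_ne_zero.2 ha)
    (fun x => measurableSet_singleton x)
    (fun x y hxy => by simpa using hxy) (measure_ne_top _ _)

lemma exists_measure_singleton_max [IsFiniteMeasure μ] {a : ℝ} (ha : μ {a} ≠ 0) :
    ∃ b, μ {b} ≠ 0 ∧ ∀ x, μ {x} ≤ μ {b} := by
  obtain ⟨b, hb, hmax⟩ := (finite_setOf_le_measure_singleton ha).exists_maximalFor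
    (fun x => μ {x}) _ ⟨a, le_refl (μ {a})⟩
  refine ⟨b, fun h => ha (le_antisymm (h ▸ hb) bot_le), fun x => ?_⟩
  rcases le_total (μ {x}) (μ {b}) with h | h
  · exact h
  · exact hmax (le_trans (show μ {a} ≤ μ {b} from hb) h) h

lemma measure_inter_preimage_singleton_le {f : ℝ → ℝ} (hf : InjOn f unitI) {M : ENNReal}
    (hM : ∀ x, μ {x} ≤ M) (x : ℝ) : μ (unitI ∩ f ⁻¹' {x}) ≤ M := by
  have hs : (unitI ∩ f ⁻¹' {x}).Subsingleton := fun y hy z hz =>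
    hf hy.1 hz.1 (hy.2.trans hz.2.symm)
  rcases hs.eq_empty_or_singleton with h | ⟨y, h⟩
  · simp [h]
  · exact h ▸ hM y

/-- Maximal atoms of a self-conformal measure have preimages under every map of the system,
which are again maximal atoms. -/
lemma exists_preimage_of_measure_singleton_max [IsFiniteMeasure μ] (hμI : μ unitIᶜ = 0)
    (hφ : ∀ i, ContinuousOn (φ i) unitI) (hinj : ∀ i, InjOn (φ i) unitI)
    (hp : ∀ i, 0 < p i) (hp1 : ∑ i, p i = 1)
    (hμ : μ = ∑ i : Λ, ENNReal.ofReal (p i) • Measure.map (φ i) μ)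
    {b : ℝ} (hb : μ {b} ≠ 0) (hmax : ∀ x, μ {x} ≤ μ {b}) (i : Λ) :
    ∃ y ∈ unitI, φ i y = b ∧ μ {y} = μ {b} := by
  classical
  have hle : ∀ j, μ (unitI ∩ φ j ⁻¹' {b}) ≤ μ {b} := fun j =>
    measure_inter_preimage_singleton_le (hinj j) hmax b
  have hsum : ∑ j, ENNReal.ofReal (p j) * μ {b} = μ {b} := by
    rw [← Finset.sum_mul, ← ENNReal.ofReal_sum_of_nonneg fun j _ => (hp j).le, hp1]
    simp
  have heq : μ (unitI ∩ φ i ⁻¹' {b}) = μ {b} := by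
    by_contra hne
    have hlt : ∑ j, ENNReal.ofReal (p j) * μ (unitI ∩ φ j ⁻¹' {b})
        < ∑ j, ENNReal.ofReal (p j) * μ {b} := by
      rw [← Finset.add_sum_erase _ _ (Finset.mem_univ i),
        ← Finset.add_sum_erase _ (fun j => ENNReal.ofReal (p j) * μ {b}) (Finset.mem_univ i)]
      refine ENNReal.add_lt_add_of_lt_of_le
        (ENNReal.sum_ne_top.2 fun j _ => ENNReal.mul_ne_top ENNReal.ofReal_ne_top
          (measure_ne_top _ _))
        (ENNReal.mul_lt_mul_right (ENNReal.ofReal_pos.2 (hp i)).ne' ENNReal.ofReal_ne_top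
          (lt_of_le_of_ne (hle i) hne))
        (Finset.sum_le_sum fun j _ => mul_le_mul_right (hle j) _)
    rw [hsum, ← measure_eq_sum_preimage hμI hφ hμ (measurableSet_singleton b)] at hlt
    exact lt_irrefl _ hlt
  have hs : (unitI ∩ φ i ⁻¹' {b}).Subsingleton := fun y hy z hz =>
    hinj i hy.1 hz.1 (hy.2.trans hz.2.symm)
  rcases hs.eq_empty_or_singleton with h | ⟨y, h⟩
  · simp [h] at heq
    exact absurd heq.symm hb
  · have hy : y ∈ unitI ∩ φ i ⁻¹' {b} := h ▸ mem_singleton y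
    exact ⟨y, hy.1, hy.2, h ▸ heq⟩

lemma measure_singleton_eq_zero [IsFiniteMeasure μ] (hμI : μ unitIᶜ = 0)
    (hφ : ∀ i, ContinuousOn (φ i) unitI) (hinj : ∀ i, InjOn (φ i) unitI)
    {ρ : ℝ} (hρ : ρ < 1)
    (hlip : ∀ i, ∀ x ∈ unitI, ∀ y ∈ unitI, |φ i x - φ i y| ≤ ρ * |x - y|)
    (hnofix : ¬ ∃ x ∈ unitI, ∀ i, φ i x = x)
    (hp : ∀ i, 0 < p i) (hp1 : ∑ i, p i = 1)
    (hμ : μ = ∑ i : Λ, ENNReal.ofReal (p i) • Measure.map (φ i) μ) (a : ℝ) :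
    μ {a} = 0 := by
  by_contra ha
  obtain ⟨b, hb, hmax⟩ := exists_measure_singleton_max ha
  have hfin := finite_setOf_le_measure_singleton hb
  have hpre : ∀ x, μ {b} ≤ μ {x} → ∀ i, ∃ y ∈ unitI, φ i y = x ∧ μ {b} ≤ μ {y} := by
    intro x hx i
    have hxb : μ {x} = μ {b} := le_antisymm (hmax x) hx
    obtain ⟨y, hy, h1, h2⟩ := exists_preimage_of_measure_singleton_max hμI hφ hinj hp hp1 hμ
      (hxb ▸ hb) (hxb ▸ hmax) i
    exact ⟨y, hy, h1, (h2.trans hxb).ge⟩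
  obtain ⟨⟨x, x'⟩, ⟨hx, hx'⟩, hdist⟩ := (hfin.prod hfin).exists_maximalFor
    (fun q : ℝ × ℝ => |q.1 - q.2|) _ ⟨(b, b), le_refl (μ {b}), le_refl (μ {b})⟩
  have hall : ∀ y y', μ {b} ≤ μ {y} → μ {b} ≤ μ {y'} → |y - y'| ≤ |x - x'| := by
    intro y y' hy hy'
    rcases le_total |y - y'| |x - x'| with h | h
    · exact h
    · exact hdist (j := (y, y')) ⟨hy, hy'⟩ h
  have hbI : b ∈ unitI := by
    by_contra h
    exact hb (measure_mono_null (singleton_subset_iff.2 h) hμI)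
  refine hnofix ⟨b, hbI, fun i => ?_⟩
  have hzero : |x - x'| ≤ 0 := by
    obtain ⟨y, hy, rfl, hyb⟩ := hpre x hx i
    obtain ⟨y', hy', rfl, hyb'⟩ := hpre x' hx' i
    have h1 := hlip i y hy y' hy'
    have h2 := hall y y' hyb hyb'
    by_contra hpos
    rcases le_total 0 ρ with h | h <;> nlinarith [abs_nonneg (y - y')]
  obtain ⟨y, -, h1, hyb⟩ := hpre b le_rfl i
  have h2 : |y - b| = 0 := le_antisymm ((hall y b hyb le_rfl).trans hzero) (abs_nonneg _)
  have h3 : y = b := by linarith [abs_eq_zero.1 h2]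
  rwa [h3] at h1

/-- A measure without atoms is uniformly small on small balls centred in a compact set. -/
lemma exists_measure_closedBall_le [IsFiniteMeasure μ] (h0 : ∀ x, μ {x} = 0)
    {e : ENNReal} (he : 0 < e) : ∃ η > 0, ∀ z ∈ unitI, μ (closedBall z η) ≤ e := by
  have hU : ∀ x, ∃ U, U ⊇ {x} ∧ IsOpen U ∧ μ U < e := fun x =>
    ({x} : Set ℝ).exists_isOpen_lt_of_lt e ((h0 x).trans_lt he)
  choose U hxU hUo hUe using hU
  obtain ⟨η, hη, h⟩ := lebesgue_number_lemma_of_metric (isCompact_Icc : IsCompact unitI) hUo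
    (fun x _ => mem_iUnion.2 ⟨x, hxU x rfl⟩)
  refine ⟨η / 2, by positivity, fun z hz => ?_⟩
  obtain ⟨x, hx⟩ := h z hz
  exact (measure_mono ((closedBall_subset_ball (by linarith)).trans hx)).trans (hUe x).le

lemma measure_inter_preimage_closedBall_le_of_diam_le [IsProbabilityMeasure μ]
    (hμI : μ unitIᶜ = 0) {e : ENNReal} {η δ s c y : ℝ}
    (hη : ∀ z ∈ unitI, μ (closedBall z η) ≤ e)
    (hc : 0 < c) (hs : 0 < s) (hδ : δ ≤ 1 / 2) (hδη : 2 * δ ≤ c * η) {g : ℝ → ℝ}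
    (hlow : ∀ x ∈ unitI, ∀ y ∈ unitI, c * s * |x - y| ≤ |g x - g y|)
    (hup : ∀ x ∈ unitI, ∀ y ∈ unitI, |g x - g y| ≤ s / 2) :
    μ (unitI ∩ g ⁻¹' closedBall y (δ * s)) ≤ e * μ (unitI ∩ g ⁻¹' closedBall y s) := by
  rcases (unitI ∩ g ⁻¹' closedBall y (δ * s)).eq_empty_or_nonempty with h | ⟨z, hz, hzy⟩
  · simp [h]
  rw [mem_preimage, mem_closedBall, Real.dist_eq] at hzy
  have hδs : δ * s ≤ 1 / 2 * s := mul_le_mul_of_nonneg_right hδ hs.le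
  have hfull : unitI ∩ g ⁻¹' closedBall y s = unitI := by
    refine inter_eq_left.2 fun x hx => ?_
    rw [mem_preimage, mem_closedBall, Real.dist_eq]
    have := abs_sub_le (g x) (g z) y
    linarith [hup x hx z hz]
  have hone : μ unitI = 1 := by
    have := measure_inter_unitI hμI univ
    rwa [inter_univ, measure_univ] at this
  rw [hfull, hone, mul_one]
  refine (measure_mono fun x hx => ?_).trans (hη z hz)
  obtain ⟨hx, hxy⟩ := hx
  rw [mem_preimage, mem_closedBall, Real.dist_eq] at hxy
  rw [mem_closedBall, Real.dist_eq]
  have h1 := abs_sub_le (g x) y (g z)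
  rw [abs_sub_comm y] at h1
  have h2 := hlow x hx z hz
  have h3 : c * s * |x - z| ≤ c * s * η := by
    have := mul_le_mul_of_nonneg_right hδη hs.le
    linarith
  exact le_of_mul_le_mul_left h3 (mul_pos hc hs)

/-- The comparison of concentric balls for the images of `μ` under compositions `g` of maps of the
system which are not too contracting at scale `s`, by induction on the number of further
compositions needed to reach that scale. -/
lemma measure_inter_preimage_closedBall_le [IsProbabilityMeasure μ] (hμI : μ unitIᶜ = 0)
    (hmaps : ∀ i, MapsTo (φ i) unitI unitI) {φ' : Λ → ℝ → ℝ} {L K ρ m : ℝ}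
    (hφ : ∀ i, HasBoundedDistortion L (φ i) (φ' i))
    (hm : ∀ i, ∀ x ∈ unitI, m ≤ |φ' i x|) (hρ : ∀ i, ∀ x ∈ unitI, |φ' i x| ≤ ρ)
    (hρ0 : 0 ≤ ρ) (hK : 0 ≤ K) (hKL : L + K * ρ ≤ K)
    (hμ : μ = ∑ i : Λ, ENNReal.ofReal (p i) • Measure.map (φ i) μ)
    {e : ENNReal} {η δ s c y : ℝ} (hη : ∀ z ∈ unitI, μ (closedBall z η) ≤ e)
    (hc : 0 < c) (hcm : c ≤ Real.exp (-K) / 2 * m) (hs : 0 < s) (hδ : δ ≤ 1 / 2)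
    (hδη : 2 * δ ≤ c * η) (n : ℕ) : ∀ (k : ℕ) (g g' : ℝ → ℝ), HasBoundedDistortion K g g' →
    (∀ x ∈ unitI, ∀ y ∈ unitI, |g x - g y| ≤ ρ ^ k * |x - y|) → ρ ^ (k + n) ≤ s / 2 →
    (∀ x ∈ unitI, ∀ y ∈ unitI, c * s * |x - y| ≤ |g x - g y|) →
    μ (unitI ∩ g ⁻¹' closedBall y (δ * s)) ≤ e * μ (unitI ∩ g ⁻¹' closedBall y s) := by
  induction n with
  | zero =>
    intro k g g' _ hlip hk hlow
    refine measure_inter_preimage_closedBall_le_of_diam_le hμI hη hc hs hδ hδη hlow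
      fun x hx y hy => ?_
    have := mul_le_mul_of_nonneg_left (abs_sub_le_one hx hy) (pow_nonneg hρ0 k)
    linarith [hlip x hx y hy, show ρ ^ k ≤ s / 2 from hk]
  | succ n ih =>
    intro k g g' hg hlip hk hlow
    by_cases hup : ∀ x ∈ unitI, ∀ y ∈ unitI, |g x - g y| ≤ s / 2
    · exact measure_inter_preimage_closedBall_le_of_diam_le hμI hη hc hs hδ hδη hlow hup
    push Not at hup
    obtain ⟨a, ha, b, hb, hab⟩ := hup
    obtain ⟨w, hw, hw'⟩ := exists_sub_eq_deriv_mul hg.hasDerivWithinAt ha hb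
    have hderiv : ∀ x ∈ unitI, Real.exp (-K) / 2 * s ≤ |g' x| := by
      intro x hx
      have h1 : s / 2 ≤ |g' w| := by
        rw [hw', abs_mul] at hab
        have := mul_le_mul_of_nonneg_left (abs_sub_le_one ha hb) (abs_nonneg (g' w))
        linarith
      have h2 := mul_le_mul_of_nonneg_left h1 (Real.exp_pos (-K)).le
      linarith [hg.exp_neg_mul_le hK hw hx]
    have hstep : ∀ i, μ (unitI ∩ (g ∘ φ i) ⁻¹' closedBall y (δ * s))
        ≤ e * μ (unitI ∩ (g ∘ φ i) ⁻¹' closedBall y s) := by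
      intro i
      refine ih (k + 1) _ _ (hg.comp (hφ i) (hmaps i) (hρ i) hK hKL) ?_
        (by rwa [add_assoc, add_comm 1]) ?_
      · intro x hx y hy
        refine (hlip _ (hmaps i hx) _ (hmaps i hy)).trans ?_
        rw [pow_succ, mul_assoc]
        exact mul_le_mul_of_nonneg_left
          (abs_sub_le_of_deriv_le (hφ i).hasDerivWithinAt (hρ i) hx hy) (pow_nonneg hρ0 k)
      · intro x hx y hy
        have h1 := le_abs_sub_of_le_deriv hg.hasDerivWithinAt hderiv (hmaps i hx) (hmaps i hy)
        have h2 := le_abs_sub_of_le_deriv (hφ i).hasDerivWithinAt (hm i) hx hy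
        have h3 := mul_le_mul_of_nonneg_left h2
          (by positivity : 0 ≤ Real.exp (-K) / 2 * s)
        have h4 := mul_le_mul_of_nonneg_right hcm
          (mul_nonneg hs.le (abs_nonneg (x - y)))
        simp only [Function.comp_apply]
        linarith
    have hdecomp : ∀ t, μ (unitI ∩ g ⁻¹' closedBall y t)
        = ∑ i, ENNReal.ofReal (p i) * μ (unitI ∩ (g ∘ φ i) ⁻¹' closedBall y t) := by
      intro t
      rw [measure_eq_sum_preimage hμI (fun i => (hφ i).continuousOn) hμ
        (hg.continuousOn.preimage_isClosed_of_isClosed isClosed_Icc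
          isClosed_closedBall).measurableSet]
      refine Finset.sum_congr rfl fun i _ => ?_
      congr 2
      ext x
      exact ⟨fun h => ⟨h.1, h.2.2⟩, fun h => ⟨h.1, hmaps i h.1, h.2⟩⟩
    rw [hdecomp, hdecomp, Finset.mul_sum]
    refine Finset.sum_le_sum fun i _ => ?_
    rw [mul_left_comm]
    exact mul_le_mul_right (hstep i) _

end SelfConformal

theorem uniformly_continuous_across_scales
    {Λ : Type} [Fintype Λ] [Nonempty Λ]
    (φ : Λ → ℝ → ℝ)
    (hanal : ∀ i, AnalyticOnNhd ℝ (φ i) unitI)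
    (hmaps : ∀ i, Set.MapsTo (φ i) unitI unitI)
    (hderiv : ∀ i, ∀ x ∈ unitI, 0 < |deriv (φ i) x| ∧ |deriv (φ i) x| < 1)
    (hnofix : ¬ ∃ x ∈ unitI, ∀ i, φ i x = x)
    (p : Λ → ℝ) (hp : ∀ i, 0 < p i) (hp1 : ∑ i, p i = 1)
    (μ : Measure ℝ) (hprob : IsProbabilityMeasure μ) (hμI : μ unitIᶜ = 0)
    (hμ : μ = ∑ i : Λ, ENNReal.ofReal (p i) • Measure.map (φ i) μ)
    :
    ∀ ε : ℝ, 0 < ε → ε < 1 →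
      ∃ δ : ℝ, 0 < δ ∧
        ∀ ψ : ℝ → ℝ, ContDiffOn ℝ 1 ψ unitI →
          (∀ x ∈ unitI, ε ≤ |derivWithin ψ unitI x| ∧ |derivWithin ψ unitI x| ≤ ε⁻¹) →
          ∀ x : ℝ, ∀ r : ℝ, 0 < r → r < 1 →
            (μ.map ψ) (Metric.closedBall x (δ * r)) ≤
              ENNReal.ofReal ε * (μ.map ψ) (Metric.closedBall x r) := by
  have hbd : ∀ i, ∃ L, HasBoundedDistortion L (φ i) (deriv (φ i)) := fun i =>
    (hanal i).exists_hasBoundedDistortion fun x hx => abs_pos.1 (hderiv i x hx).1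
  choose L₀ hL₀ using hbd
  have hne : unitI.Nonempty := ⟨0, by simp [unitI]⟩
  have hcont : ∀ i, ContinuousOn (fun x => |deriv (φ i) x|) unitI := fun i =>
    (hanal i).deriv.continuousOn.abs
  choose u hu humin using fun i =>
    (isCompact_Icc : IsCompact unitI).exists_isMinOn hne (hcont i)
  choose v hv hvmax using fun i =>
    (isCompact_Icc : IsCompact unitI).exists_isMaxOn hne (hcont i)
  obtain ⟨i₀, hi₀⟩ := Finite.exists_min fun i => |deriv (φ i) (u i)|
  obtain ⟨j₀, hj₀⟩ := Finite.exists_max fun i => |deriv (φ i) (v i)|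
  obtain ⟨k₀, hk₀⟩ := Finite.exists_max L₀
  set m := |deriv (φ i₀) (u i₀)|
  set ρ := |deriv (φ j₀) (v j₀)|
  set L := max (L₀ k₀) 0
  have hm0 : 0 < m := (hderiv _ _ (hu _)).1
  have hρ0 : 0 ≤ ρ := abs_nonneg _
  have hρ1 : ρ < 1 := (hderiv _ _ (hv _)).2
  have hm : ∀ i, ∀ x ∈ unitI, m ≤ |deriv (φ i) x| := fun i x hx =>
    (hi₀ i).trans (humin i hx)
  have hρ : ∀ i, ∀ x ∈ unitI, |deriv (φ i) x| ≤ ρ := fun i x hx =>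
    le_trans (hvmax i hx) (hj₀ i)
  have hL : ∀ i, HasBoundedDistortion L (φ i) (deriv (φ i)) := fun i =>
    ⟨(hL₀ i).hasDerivWithinAt, (hL₀ i).deriv_ne_zero, fun x hx y hy =>
      ((hL₀ i).log_sub_le x hx y hy).trans
        (mul_le_mul_of_nonneg_right ((hk₀ i).trans (le_max_left _ _)) (abs_nonneg _))⟩
  have hLpos : 0 ≤ L := le_max_right _ _
  set K := L / (1 - ρ)
  have hK : 0 ≤ K := div_nonneg hLpos (by linarith)
  have hKL : L + K * ρ ≤ K := by
    have : K * (1 - ρ) = L := div_mul_cancel₀ _ (by linarith)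
    linarith
  have hm1 : m < 1 := (hderiv _ _ (hu _)).2
  set c := Real.exp (-K) / 2 * m with hc_def
  have hc : 0 < c := by positivity
  have hc1 : c ≤ 1 := by
    have : Real.exp (-K) ≤ 1 := Real.exp_le_one_iff.2 (by linarith)
    have := mul_le_mul this hm1.le hm0.le zero_le_one
    linarith
  have hatom : ∀ x, μ {x} = 0 := measure_singleton_eq_zero hμI
    (fun i => (hL i).continuousOn)
    (fun i x hx y hy hxy => by
      have := le_abs_sub_of_le_deriv (hL i).hasDerivWithinAt (hm i) hx hy
      rw [hxy, sub_self, abs_zero] at this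
      have := nonpos_of_mul_nonpos_right this hm0
      exact sub_eq_zero.1 (abs_nonpos_iff.1 this))
    hρ1 (fun i x hx y hy => abs_sub_le_of_deriv_le (hL i).hasDerivWithinAt (hρ i) hx hy)
    hnofix hp hp1 hμ
  intro ε hε hε1
  obtain ⟨η, hη0, hη⟩ := exists_measure_closedBall_le hatom (ENNReal.ofReal_pos.2 hε)
  set δ := min (1 / 2) (c * η / 2)
  have hδ0 : 0 < δ := by positivity
  have hδ : δ ≤ 1 / 2 := min_le_left _ _
  have hδη : 2 * δ ≤ c * η := by linarith [min_le_right (1 / 2) (c * η / 2)]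
  have hball : ∀ y s : ℝ, 0 < s → s < 1 →
      μ (closedBall y (δ * s)) ≤ ENNReal.ofReal ε * μ (closedBall y s) := by
    intro y s hs hs1
    obtain ⟨n, hn⟩ := exists_pow_lt_of_lt_one (half_pos hs) hρ1
    have h := measure_inter_preimage_closedBall_le (y := y) hμI hmaps hL hm hρ hρ0 hK hKL hμ hη hc
      hc_def.le hs hδ hδη n 0 id _ (.id hK) (by simp) (by simpa using hn.le) (fun x _ y _ => by
        have := mul_le_mul hc1 hs1.le hs.le zero_le_one
        simpa using mul_le_mul_of_nonneg_right this (abs_nonneg (x - y)))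
    simpa only [preimage_id, measure_inter_unitI hμI] using h
  refine ⟨δ * (ε / 2) * (ε / 2), by positivity, fun ψ hψ hψ' x r hr hr1 => ?_⟩
  have hψd : ∀ z ∈ unitI, HasDerivWithinAt ψ (derivWithin ψ unitI z) unitI z := fun z hz =>
    (hψ.differentiableOn one_ne_zero z hz).hasDerivWithinAt
  have hψm := aemeasurable_of_continuousOn_unitI hμI hψ.continuousOn
  rw [Measure.map_apply_of_aemeasurable hψm measurableSet_closedBall,
    Measure.map_apply_of_aemeasurable hψm measurableSet_closedBall,
    ← measure_inter_unitI hμI, ← measure_inter_unitI hμI (ψ ⁻¹' closedBall x r)]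
  set δ' := δ * (ε / 2) * (ε / 2) with hδ'
  rcases (unitI ∩ ψ ⁻¹' closedBall x (δ' * r)).eq_empty_or_nonempty with h | ⟨y, hy, hyx⟩
  · simp [h]
  rw [mem_preimage, mem_closedBall, Real.dist_eq] at hyx
  have hδ'2 : δ' ≤ 1 / 2 := by
    have : (ε / 2) * (ε / 2) ≤ 1 := by nlinarith
    have := mul_le_mul hδ this (by positivity) (by norm_num)
    linarith
  calc μ (unitI ∩ ψ ⁻¹' closedBall x (δ' * r))
      ≤ μ (closedBall y (δ * (ε / 2 * r))) := by
        refine measure_mono fun z hz => ?_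
        obtain ⟨hz, hzx⟩ := hz
        rw [mem_preimage, mem_closedBall, Real.dist_eq] at hzx
        rw [mem_closedBall, Real.dist_eq]
        have h1 := le_abs_sub_of_le_deriv hψd (fun w hw => (hψ' w hw).1) hz hy
        have h2 := abs_sub_le (ψ z) x (ψ y)
        rw [abs_sub_comm x] at h2
        refine le_of_mul_le_mul_left (a := ε) ?_ hε
        have : 2 * (δ' * r) = ε * (δ * (ε / 2 * r)) := by rw [hδ']; ring
        linarith
    _ ≤ ENNReal.ofReal ε * μ (closedBall y (ε / 2 * r)) :=
        hball y _ (by positivity) (by nlinarith)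
    _ ≤ ENNReal.ofReal ε * μ (unitI ∩ ψ ⁻¹' closedBall x r) := by
        rw [← measure_inter_unitI hμI (closedBall y (ε / 2 * r))]
        refine mul_le_mul_right (measure_mono ?_) _
        rintro z ⟨hzI, hz⟩
        rw [mem_closedBall, Real.dist_eq] at hz
        refine ⟨hzI, ?_⟩
        rw [mem_preimage, mem_closedBall, Real.dist_eq]
        have h1 := abs_sub_le_of_deriv_le hψd (fun w hw => (hψ' w hw).2) hzI hy
        have h2 := mul_le_mul_of_nonneg_left hz (inv_pos.2 hε).le
        have h3 : ε⁻¹ * (ε / 2 * r) = r / 2 := by field_simp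
        have h4 := mul_le_mul_of_nonneg_right hδ'2 hr.le
        have h5 := abs_sub_le (ψ z) (ψ y) x
        linarith
end
end
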